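/- Let 1 < p ≤ q with p > 2, set κ₁ = p−1, κ₂ = q−1, let 0 < ε ≤ 1 and f⃗₁ ∈ Y_{κ₁}(ε), f⃗₂ ∈ Y_{κ₂}(ε), and set w₀ = K[f⃗₁], v₀ = K[f⃗₂]. If (u₁, u₂) and (u₁*, u₂*) in X² × X² both satisfy ‖u₁ − w₀‖_{Z²(κ₁)} + ‖u₂ − v₀‖_{Z²(κ₂)} ≤ ε (respectively with u₁*, u₂*), then ‖R(|∂_t u₂|^p − |∂_t u₂*|^p)‖_{Z²(κ₁)} ≤ C ε^{p−1} ‖u₂ − u₂*‖_{Z²(κ₂)} and ‖R(|∂_t u₁|^q − |∂_t u₁*|^q)‖_{Z²(κ₂)} ≤ C ε^{q−1} ‖u₁ − u₁*‖_{Z²(κ₁)}, where C is a constant depending only on p and q. -/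

import Mathlib

open Real MeasureTheory Filter

noncomputable section

/-- Partial derivative with respect to the first (radial) variable. -/
def pdr (u : ℝ → ℝ → ℝ) : ℝ → ℝ → ℝ := fun r t => deriv (fun r' => u r' t) r

/-- Partial derivative with respect to the second (time) variable. -/
def pdt (u : ℝ → ℝ → ℝ) : ℝ → ℝ → ℝ := fun r t => deriv (fun t' => u r t') t

/-- `[u(r,t)]₁ = |u| + r (|∂_r u| + |∂_t u|)`. -/
def bracket1 (u : ℝ → ℝ → ℝ) (r t : ℝ) : ℝ :=
  |u r t| + r * (|pdr u r t| + |pdt u r t|)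

/-- `[u(r,t)]₂ = |u| + (1+r)(|∂_r u| + |∂_t u|) + r (|∂_r² u| + |∂_r∂_t u| + |∂_t² u|)`. -/
def bracket2 (u : ℝ → ℝ → ℝ) (r t : ℝ) : ℝ :=
  |u r t| + (1 + r) * (|pdr u r t| + |pdt u r t|) +
    r * (|pdr (pdr u) r t| + |pdr (pdt u) r t| + |pdt (pdt u) r t|)

def bracketS (s : ℕ) (u : ℝ → ℝ → ℝ) (r t : ℝ) : ℝ :=
  if s = 1 then bracket1 u r t else bracket2 u r t

/-- Membership in the class `X^s`: `u ∈ C^{s-1}(ℝ × [0,∞))`, `r u ∈ C^s(ℝ × [0,∞))`,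
and `u` is even in `r`. -/
def memX (s : ℕ) (u : ℝ → ℝ → ℝ) : Prop :=
  ContDiffOn ℝ ((s - 1 : ℕ) : ℕ∞) (fun z : ℝ × ℝ => u z.1 z.2) (Set.univ ×ˢ Set.Ici (0:ℝ)) ∧
  ContDiffOn ℝ ((s : ℕ) : ℕ∞) (fun z : ℝ × ℝ => z.1 * u z.1 z.2) (Set.univ ×ˢ Set.Ici (0:ℝ)) ∧
  ∀ r t : ℝ, 0 ≤ t → u (-r) t = u r t

/-- The set of values whose supremum is `‖u‖_{X^s(ν)}`. -/
def XSet (s : ℕ) (ν : ℝ) (u : ℝ → ℝ → ℝ) : Set ℝ :=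
  {x | ∃ r t : ℝ, 0 < r ∧ 0 ≤ t ∧ x = bracketS s u r t * (1 + |r - t|) ^ ν}

/-- `‖u‖_{X^s(ν)}`. -/
def Xnorm (s : ℕ) (ν : ℝ) (u : ℝ → ℝ → ℝ) : ℝ := sSup (XSet s ν u)

/-- `u ∈ X^s(ν)`. -/
def memXnu (s : ℕ) (ν : ℝ) (u : ℝ → ℝ → ℝ) : Prop := memX s u ∧ BddAbove (XSet s ν u)

/-- The set of values whose supremum is `‖u‖_{Z^s(ν)}`. -/
def ZSet (s : ℕ) (ν : ℝ) (u : ℝ → ℝ → ℝ) : Set ℝ :=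
  {x | ∃ r t : ℝ, 0 < r ∧ 0 ≤ t ∧
    x = bracketS s u r t * (1 + r + t) ^ (ν - 1) * (1 + |r - t|)}

/-- `‖u‖_{Z^s(ν)}`. -/
def Znorm (s : ℕ) (ν : ℝ) (u : ℝ → ℝ → ℝ) : ℝ := sSup (ZSet s ν u)

/-- `u ∈ Z^s(ν)`. -/
def memZnu (s : ℕ) (ν : ℝ) (u : ℝ → ℝ → ℝ) : Prop := memX s u ∧ BddAbove (ZSet s ν u)

/-- `|||f⃗(r)|||`. -/
def tripleNorm (f g : ℝ → ℝ) (r : ℝ) : ℝ :=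
  |f r| + (1 + r) * (|deriv f r| + |g r|) + r * (|deriv (deriv f) r| + |deriv g r|)

def tnorm (fg : (ℝ → ℝ) × (ℝ → ℝ)) (r : ℝ) : ℝ := tripleNorm fg.1 fg.2 r

/-- `f⃗ ∈ Y_ν(ε)`. -/
def memY (ν ε : ℝ) (fg : (ℝ → ℝ) × (ℝ → ℝ)) : Prop :=
  ContDiff ℝ 1 fg.1 ∧ Continuous fg.2 ∧
  (∀ r : ℝ, fg.1 (-r) = fg.1 r) ∧ (∀ r : ℝ, fg.2 (-r) = fg.2 r) ∧
  ContDiff ℝ 2 (fun r : ℝ => r * fg.1 r) ∧ ContDiff ℝ 1 (fun r : ℝ => r * fg.2 r) ∧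
  ∀ r : ℝ, 0 < r → (1 + r) ^ ν * tnorm fg r ≤ ε

/-- Solution operator `K[f⃗]` of the radial homogeneous wave equation. -/
def Kop (fg : (ℝ → ℝ) × (ℝ → ℝ)) : ℝ → ℝ → ℝ := fun r t =>
  (1 / (2 * r)) * ((∫ l in (r - t)..(r + t), l * fg.2 l) +
    deriv (fun s : ℝ => ∫ l in (r - s)..(r + s), l * fg.1 l) t)

/-- Duhamel operator `L(F)` for the initial value problem with zero data. -/
def Lop (F : ℝ → ℝ → ℝ) : ℝ → ℝ → ℝ := fun r t =>
  (1 / (2 * r)) * ∫ s in (0:ℝ)..t, (∫ l in (r - (t - s))..(r + (t - s)), l * F l s)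

/-- Operator `R(F)` associated with the final value problem. -/
def Rop (F : ℝ → ℝ → ℝ) : ℝ → ℝ → ℝ := fun r t =>
  (1 / (2 * r)) * ∫ s in Set.Ioi t, (∫ l in ((s - t) - r)..((s - t) + r), l * F l s)

/-- Values whose supremum is `M₀(F)`. -/
def M0Set (α β γ δ : ℝ) (F : ℝ → ℝ → ℝ) : Set ℝ :=
  {x | ∃ r t : ℝ, 0 < r ∧ 0 ≤ t ∧
    x = |F r t| * r ^ α * (1 + r) ^ β * (1 + r + t) ^ γ * (1 + |r - t|) ^ δ}

/-- Values whose supremum is the second summand of `M₁(F)`. -/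
def M1Set (α β γ δ : ℝ) (F : ℝ → ℝ → ℝ) : Set ℝ :=
  {x | ∃ r t : ℝ, 0 < r ∧ 0 ≤ t ∧
    x = |pdr F r t| * r ^ (α + 1) * (1 + r) ^ (β - 1) * (1 + r + t) ^ γ * (1 + |r - t|) ^ δ}

/-- `M_s(F)` for `s = 0, 1`. -/
def Mnorm (s : ℕ) (α β γ δ : ℝ) (F : ℝ → ℝ → ℝ) : ℝ :=
  if s = 0 then sSup (M0Set α β γ δ F)
  else sSup (M0Set α β γ δ F) + sSup (M1Set α β γ δ F)

/-- Finiteness of `M_s(F)`. -/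
def MFinite (s : ℕ) (α β γ δ : ℝ) (F : ℝ → ℝ → ℝ) : Prop :=
  BddAbove (M0Set α β γ δ F) ∧ (s = 0 ∨ BddAbove (M1Set α β γ δ F))

/-- Energy norm `‖w(t)‖_E` of the radial function `w(|x|,t)` on `ℝ³`. -/
def energy (w : ℝ → ℝ → ℝ) (t : ℝ) : ℝ :=
  Real.sqrt ((1 / 2) * ∫ x : EuclideanSpace ℝ (Fin 3),
    ((pdt w ‖x‖ t) ^ 2 + (pdr w ‖x‖ t) ^ 2))

/-- The nonlinearity `|∂_t u|^p`. -/
def NLt (p : ℝ) (u : ℝ → ℝ → ℝ) : ℝ → ℝ → ℝ := fun r t => |pdt u r t| ^ p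

/-- `(u₁,u₂)` solves the radially symmetric system (S). -/
def solvesS (p q : ℝ) (u₁ u₂ : ℝ → ℝ → ℝ) : Prop :=
  ∀ r t : ℝ, 0 < r → 0 ≤ t →
    pdt (pdt u₁) r t - (pdr (pdr u₁) r t + (2 / r) * pdr u₁ r t) = |pdt u₂ r t| ^ p ∧
    pdt (pdt u₂) r t - (pdr (pdr u₂) r t + (2 / r) * pdr u₂ r t) = |pdt u₁ r t| ^ q

/-- Initial data `(u(·,0), ∂_t u(·,0))` of a function `u(r,t)`. -/
def datum (u : ℝ → ℝ → ℝ) : (ℝ → ℝ) × (ℝ → ℝ) := (fun r => u r 0, fun r => pdt u r 0)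

/-- The sequence `a₀ = 1`, `a_{j+1} = κ₁ (a_j - 1) + κ₂`. -/
def aseq (κ₁ κ₂ : ℝ) : ℕ → ℝ
  | 0 => 1
  | n + 1 => κ₁ * (aseq κ₁ κ₂ n - 1) + κ₂

/-- Auxiliary iteration producing the pairs `((w_j, v_j), (w_{j+1}, v_{j+1}))`. -/
def iterAux (p q : ℝ) (fg1 fg2 : (ℝ → ℝ) × (ℝ → ℝ)) :
    ℕ → ((ℝ → ℝ → ℝ) × (ℝ → ℝ → ℝ)) × ((ℝ → ℝ → ℝ) × (ℝ → ℝ → ℝ))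
  | 0 =>
    ((Kop fg1, Kop fg2),
     (Kop fg1 + Lop (NLt p (Kop fg2)),
      Kop fg2 + Rop (NLt q (Kop fg1 + Lop (NLt p (Kop fg2))))))
  | n + 1 =>
    let prev := iterAux p q fg1 fg2 n
    let wnext := prev.2.1 + Lop (NLt p prev.2.2 - NLt p prev.1.2)
    (prev.2, (wnext, prev.2.2 + Rop (NLt q wnext - NLt q prev.2.1)))

/-- The iterate `w_j`. -/
def witer (p q : ℝ) (fg1 fg2 : (ℝ → ℝ) × (ℝ → ℝ)) (j : ℕ) : ℝ → ℝ → ℝ :=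
  (iterAux p q fg1 fg2 j).1.1

/-- The iterate `v_j`. -/
def viter (p q : ℝ) (fg1 fg2 : (ℝ → ℝ) × (ℝ → ℝ)) (j : ℕ) : ℝ → ℝ → ℝ :=
  (iterAux p q fg1 fg2 j).1.2

/-- The starred iterates `(w_j^*, v_j^*)` built from a solution `(u₁,u₂)`. -/
def starIter (p q : ℝ) (φ1 : (ℝ → ℝ) × (ℝ → ℝ)) (u₁ u₂ : ℝ → ℝ → ℝ) :
    ℕ → (ℝ → ℝ → ℝ) × (ℝ → ℝ → ℝ)
  | 0 => (Kop φ1, u₂ - Rop (NLt q u₁))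
  | n + 1 =>
    let w := Kop φ1 + Lop (NLt p (starIter p q φ1 u₁ u₂ n).2)
    (w, (u₂ - Rop (NLt q u₁)) + Rop (NLt q w))

/-- The quantity `d₁(w, 0) = ‖w‖_{Z²(κ₁ a_{ℓ+1})} + ‖w‖_{Z¹(κ₁ a_{ℓ+1})}^{p-1}` (applied to
differences). -/
def dOne (p q : ℝ) (ℓ : ℕ) (w : ℝ → ℝ → ℝ) : ℝ :=
  Znorm 2 ((p - 1) * aseq (p - 1) (q * (p - 1) - 1) (ℓ + 1)) w +
    Znorm 1 ((p - 1) * aseq (p - 1) (q * (p - 1) - 1) (ℓ + 1)) w ^ (p - 1)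

/-- The quantity `d₂(w, 0) = ‖w‖_{Z²(a_{ℓ+1})} + ‖w‖_{Z¹(a_{ℓ+1})}^{p-1}` (applied to
differences). -/
def dTwo (p q : ℝ) (ℓ : ℕ) (w : ℝ → ℝ → ℝ) : ℝ :=
  Znorm 2 (aseq (p - 1) (q * (p - 1) - 1) (ℓ + 1)) w +
    Znorm 1 (aseq (p - 1) (q * (p - 1) - 1) (ℓ + 1)) w ^ (p - 1)

/-- Membership in the metric ball `D_ε` around `(w_{ℓ+1}, v_{ℓ+1})`. -/
def memD (p q ε : ℝ) (ℓ : ℕ) (fg1 fg2 : (ℝ → ℝ) × (ℝ → ℝ)) (u₁ u₂ : ℝ → ℝ → ℝ) : Prop :=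
  memX 2 u₁ ∧ memX 2 u₂ ∧
  BddAbove (ZSet 2 ((p - 1) * aseq (p - 1) (q * (p - 1) - 1) (ℓ + 1))
    (u₁ - witer p q fg1 fg2 (ℓ + 1))) ∧
  BddAbove (ZSet 1 ((p - 1) * aseq (p - 1) (q * (p - 1) - 1) (ℓ + 1))
    (u₁ - witer p q fg1 fg2 (ℓ + 1))) ∧
  BddAbove (ZSet 2 (aseq (p - 1) (q * (p - 1) - 1) (ℓ + 1))
    (u₂ - viter p q fg1 fg2 (ℓ + 1))) ∧
  BddAbove (ZSet 1 (aseq (p - 1) (q * (p - 1) - 1) (ℓ + 1))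
    (u₂ - viter p q fg1 fg2 (ℓ + 1))) ∧
  dOne p q ℓ (u₁ - witer p q fg1 fg2 (ℓ + 1)) + dTwo p q ℓ (u₂ - viter p q fg1 fg2 (ℓ + 1))
    ≤ ε ^ ((p - 1) * (q + (ℓ : ℝ) * (p + q - 2)))

section

open Real MeasureTheory Filter Set Topology

noncomputable section

/-! ### Weights -/

lemma one_le_w (x : ℝ) : 1 ≤ 1 + |x| := by linarith [abs_nonneg x]

lemma integrable_jap {k : ℝ} (hk : 1 < k) : Integrable (fun x : ℝ => (1 + |x|) ^ (-k)) := by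
  have := integrable_one_add_norm (E := ℝ) (μ := volume) (r := k) (by simpa using hk)
  simpa using this

/-- The constant `∫ (1+|x|)^{-k}`. -/
def cJ (k : ℝ) : ℝ := ∫ x : ℝ, (1 + |x|) ^ (-k)

lemma cJ_nonneg (k : ℝ) : 0 ≤ cJ k :=
  integral_nonneg fun x => by positivity

lemma integrable_jap_sub {k : ℝ} (hk : 1 < k) (c : ℝ) :
    Integrable (fun x : ℝ => (1 + |x - c|) ^ (-k)) :=
  (integrable_jap hk).comp_sub_right c

lemma integral_jap_sub (k c : ℝ) : ∫ x : ℝ, (1 + |x - c|) ^ (-k) = cJ k :=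
  integral_sub_right_eq_self (fun x : ℝ => (1 + |x|) ^ (-k)) c

lemma integrable_jap_two {k : ℝ} (hk : 1 < k) (c : ℝ) :
    Integrable (fun x : ℝ => (1 + |c - 2 * x|) ^ (-k)) := by
  have h := ((integrable_jap hk).comp_sub_left c).comp_mul_left' (R := 2) (by norm_num)
  exact h

lemma integral_jap_two (k c : ℝ) : ∫ x : ℝ, (1 + |c - 2 * x|) ^ (-k) ≤ cJ k := by
  have h := Measure.integral_comp_mul_left (fun x : ℝ => (1 + |c - x|) ^ (-k)) 2
  have h2 := integral_sub_left_eq_self (fun x : ℝ => (1 + |x|) ^ (-k)) volume c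
  rw [h, h2, ← cJ]
  have := cJ_nonneg k
  rw [abs_of_pos (by norm_num), smul_eq_mul]
  linarith

lemma integrableOn_shift {k c : ℝ} (hk : 1 < k) (hc : 0 < c) :
    IntegrableOn (fun x : ℝ => (x + c) ^ (-k)) (Ioi 0) :=
  integrableOn_add_rpow_Ioi_of_lt (by linarith) (by linarith)

lemma setIntegral_Ioi_shift (f : ℝ → ℝ) (a c : ℝ) :
    ∫ x in Ioi a, f (x + c) = ∫ x in Ioi (a + c), f x := by
  have h := (measurePreserving_add_right (volume : Measure ℝ) c).setIntegral_preimage_emb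
    (measurableEmbedding_addRight c) f (Ioi (a + c))
  rw [← h]
  congr 2
  ext x; simp

lemma integral_shift {k c : ℝ} (hk : 1 < k) (hc : 0 < c) :
    ∫ x in Ioi (0:ℝ), (x + c) ^ (-k) = c ^ (-(k - 1)) / (k - 1) := by
  have h : ∫ x in Ioi (0:ℝ), (x + c) ^ (-k) = ∫ x in Ioi (0 + c), x ^ (-k) :=
    setIntegral_Ioi_shift (fun x : ℝ => x ^ (-k)) 0 c
  have h2 := integral_Ioi_rpow_of_lt (a := -k) (by linarith) hc
  rw [h, zero_add, h2]
  rw [show -k + 1 = -(k-1) by ring, neg_div_neg_eq]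

/-- Target weight. -/
def wB (k r t : ℝ) : ℝ := (1 + r + t) ^ (-(k - 1)) * (1 + |r - t|)⁻¹

/-- Source weight. -/
def wt (k d l s : ℝ) : ℝ := (1 + |l|) ^ (-k) * (1 + |(|l| - s)|) ^ (-d)

lemma wB_nonneg {k r t : ℝ} (hr : 0 ≤ r) (ht : 0 ≤ t) : 0 ≤ wB k r t := by
  unfold wB; positivity

lemma wt_nonneg (k d l s : ℝ) : 0 ≤ wt k d l s := by
  unfold wt; positivity

lemma wt_le {k d : ℝ} (hd : 0 ≤ d) (l s : ℝ) : wt k d l s ≤ (1 + |l|) ^ (-k) := by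
  unfold wt
  have : (1 + |(|l| - s)|) ^ (-d) ≤ 1 :=
    Real.rpow_le_one_of_one_le_of_nonpos (one_le_w _) (by linarith)
  have h2 : 0 ≤ (1 + |l|) ^ (-k) := by positivity
  nlinarith

lemma rpow_neg_le_of_le_mul {x y c k : ℝ} (hx : 0 < x) (hc : 0 < c) (hk : 0 ≤ k)
    (h : x ≤ c * y) : y ^ (-k) ≤ c ^ k * x ^ (-k) := by
  have hy : 0 < y := by by_contra hy; nlinarith
  have h1 : (c * y) ^ (-k) ≤ x ^ (-k) := Real.rpow_le_rpow_of_nonpos hx h (by linarith)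
  rw [Real.mul_rpow hc.le hy.le, Real.rpow_neg hc.le] at h1
  have hck : 0 < c ^ k := by positivity
  rw [inv_mul_le_iff₀ hck] at h1
  exact h1

/-- `a^{-k} b^{-d} ≤ c^k x^{-k} b^{-(d-k)}` if `x ≤ c a b`. -/
lemma prod_rpow_le {x a b c k d : ℝ} (hx : 0 < x) (ha : 0 < a) (hb : 0 < b) (hc : 0 < c)
    (hk : 0 ≤ k) (h : x ≤ c * (a * b)) :
    a ^ (-k) * b ^ (-d) ≤ c ^ k * x ^ (-k) * b ^ (-(d - k)) := by
  have h1 := rpow_neg_le_of_le_mul hx hc hk h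
  rw [Real.mul_rpow ha.le hb.le] at h1
  have h2 : b ^ (-d) = b ^ (-k) * b ^ (-(d-k)) := by
    rw [← Real.rpow_add hb]; congr 1; ring
  rw [h2, ← mul_assoc]
  exact mul_le_mul_of_nonneg_right h1 (by positivity)

/-- Pointwise bound in the incoming case. -/
lemma wt_in {k d r t s : ℝ} (hk : 0 ≤ k) (hkd : k ≤ d) (hr : 0 ≤ r) (ht : 0 ≤ t) (hs : 0 ≤ s) :
    wt k d (s - r) (s + t) ≤ 3 ^ k * (1 + r + t) ^ (-k) *
      ((1 + |(r - t) - 2 * s|) ^ (-(d - k)) + (1 + |s - r|) ^ (-k)) := by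
  have hX : 0 < 1 + r + t := by linarith
  have h3 : 0 ≤ 3 ^ k * (1 + r + t) ^ (-k) := by positivity
  rcases le_total s r with h | h
  · have e1 : |s - r| = r - s := by rw [abs_of_nonpos (by linarith)]; ring
    have : wt k d (s - r) (s + t) = (1 + (r - s)) ^ (-k) * (1 + |(r - t) - 2 * s|) ^ (-d) := by
      unfold wt; rw [e1]; congr 4; ring
    rw [this, mul_add]
    have h4 : 1 + r + t ≤ 3 * ((1 + (r - s)) * (1 + |(r - t) - 2 * s|)) := by
      have := neg_abs_le ((r - t) - 2 * s)
      have := abs_nonneg ((r - t) - 2 * s)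
      nlinarith
    have := prod_rpow_le (d := d) hX (by linarith) (by positivity) (by norm_num) hk h4
    have h5 : 0 ≤ 3 ^ k * (1 + r + t) ^ (-k) * (1 + |s - r|) ^ (-k) := by positivity
    linarith
  · have e1 : |s - r| = s - r := by rw [abs_of_nonneg (by linarith)]
    have : wt k d (s - r) (s + t) = (1 + |s - r|) ^ (-k) * (1 + r + t) ^ (-d) := by
      unfold wt; rw [e1, show s - r - (s + t) = -(r + t) by ring, abs_neg,
        abs_of_nonneg (by linarith)]; congr 2; ring
    rw [this, mul_add]
    have h6 : (1 + r + t) ^ (-d) ≤ (1 + r + t) ^ (-k) :=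
      Real.rpow_le_rpow_of_exponent_le (by linarith) (by linarith)
    have h7 : (1:ℝ) ≤ 3 ^ k := Real.one_le_rpow (by norm_num) hk
    have h5 : 0 ≤ 3 ^ k * (1 + r + t) ^ (-k) * (1 + |(r - t) - 2 * s|) ^ (-(d - k)) := by
      positivity
    have h8 : (1 + r + t) ^ (-d) ≤ 3 ^ k * (1 + r + t) ^ (-k) := by
      have : 0 ≤ (1 + r + t) ^ (-k) := by positivity
      nlinarith
    have h9 : 0 ≤ (1 + |s - r|) ^ (-k) := by positivity
    nlinarith

lemma X_le_wB {k r t : ℝ} (hk : 1 < k) (hr : 0 ≤ r) (ht : 0 ≤ t) :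
    (1 + r + t) ^ (-k) ≤ wB k r t := by
  have hX : 0 < 1 + r + t := by linarith
  have : (1 + r + t) ^ (-k) = (1 + r + t) ^ (-(k - 1)) * (1 + r + t)⁻¹ := by
    rw [← Real.rpow_neg_one, ← Real.rpow_add hX]; congr 1; ring
  rw [this, wB]
  have : |r - t| ≤ r + t := by rw [abs_le]; constructor <;> linarith
  have h2 : (1 + r + t)⁻¹ ≤ (1 + |r - t|)⁻¹ := inv_anti₀ (by positivity) (by linarith)
  exact mul_le_mul_of_nonneg_left h2 (by positivity)

/-- Pointwise bound in the outgoing case. -/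
lemma wt_out {k d r t s : ℝ} (hr : 0 ≤ r) (hs : 0 ≤ s) :
    wt k d (s - -r) (s + t) = (s + (1 + r)) ^ (-k) * (1 + |r - t|) ^ (-d) := by
  unfold wt
  rw [abs_of_nonneg (show 0 ≤ s - -r by linarith)]
  congr 2
  · ring
  · congr 2; ring

lemma out_le_wB {k d r t : ℝ} (hk : 1 < k) (hkd : k ≤ d) (hr : 0 ≤ r) (ht : 0 ≤ t) :
    (1 + r) ^ (-(k - 1)) * (1 + |r - t|) ^ (-d) ≤ 2 ^ (k - 1) * wB k r t := by
  have hX : 0 < 1 + r + t := by linarith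
  have h4 : 1 + r + t ≤ 2 * ((1 + r) * (1 + |r - t|)) := by
    have := neg_abs_le (r - t)
    have := abs_nonneg (r - t)
    nlinarith
  have := prod_rpow_le (d := d) hX (by linarith) (by positivity) (by norm_num)
    (show 0 ≤ k - 1 by linarith) h4
  refine this.trans ?_
  rw [wB, mul_assoc]
  gcongr
  rw [← Real.rpow_neg_one]
  exact Real.rpow_le_rpow_of_exponent_le (one_le_w _) (by linarith)

end

end

section

open Real MeasureTheory Filter Set Topology

noncomputable section

/-- Integral along characteristics. -/
def Iop (G : ℝ → ℝ → ℝ) (ρ t : ℝ) : ℝ := ∫ σ in Ioi (0:ℝ), G (σ - ρ) (σ + t)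

/-- Admissible source functions. -/
structure Src (k d A : ℝ) (G : ℝ → ℝ → ℝ) : Prop where
  cont : Continuous (Function.uncurry G)
  bd0 : ∀ l s, |G l s| ≤ A * (1 + |l|) ^ (-k)
  bd : ∀ l s, 0 ≤ s → |G l s| ≤ A * wt k d l s

variable {k d A : ℝ} {G Gl Gs : ℝ → ℝ → ℝ}

lemma Src.A_nonneg (h : Src k d A G) : 0 ≤ A := by
  have := (abs_nonneg _).trans (h.bd0 0 0)
  simpa using this

lemma Src.cont2 (h : Src k d A G) {X : Type*} [TopologicalSpace X] {f g : X → ℝ}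
    (hf : Continuous f) (hg : Continuous g) : Continuous (fun x => G (f x) (g x)) :=
  h.cont.comp (hf.prodMk hg)

lemma Src.shift_bd (h : Src k d A G) (hk : 0 ≤ k) (ρ₀ ρ s σ : ℝ) (hρ : |ρ - ρ₀| ≤ 1) :
    |G (σ - ρ) s| ≤ A * 2 ^ k * (1 + |σ - ρ₀|) ^ (-k) := by
  refine (h.bd0 _ _).trans ?_
  rw [mul_assoc]
  refine mul_le_mul_of_nonneg_left ?_ h.A_nonneg
  refine rpow_neg_le_of_le_mul (by positivity) (by norm_num) hk ?_
  have : |σ - ρ₀| ≤ |σ - ρ| + |ρ - ρ₀| := abs_sub_le _ _ _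
  have := abs_nonneg (σ - ρ)
  linarith

lemma Src.integrable (h : Src k d A G) (hk : 1 < k) (ρ t : ℝ) :
    IntegrableOn (fun σ => G (σ - ρ) (σ + t)) (Ioi 0) := by
  have h1 : Integrable (fun σ => A * 2 ^ k * (1 + |σ - ρ|) ^ (-k)) :=
    (integrable_jap_sub hk ρ).const_mul _
  refine (h1.mono' ?_ ?_).integrableOn
  · exact (h.cont2 (by fun_prop) (by fun_prop)).aestronglyMeasurable
  · exact Eventually.of_forall fun σ => h.shift_bd (by linarith) ρ ρ _ σ (by simp)

lemma Src.Iop_cont (h : Src k d A G) (hk : 1 < k) :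
    Continuous (Function.uncurry (Iop G)) := by
  rw [continuous_iff_continuousAt]
  rintro ⟨ρ₀, t₀⟩
  refine continuousAt_of_dominated (bound := fun σ => A * 2 ^ k * (1 + |σ - ρ₀|) ^ (-k))
    ?_ ?_ ?_ ?_
  · exact Eventually.of_forall fun z =>
      (h.cont2 (by fun_prop) (by fun_prop)).aestronglyMeasurable
  · have : ∀ᶠ z : ℝ × ℝ in 𝓝 (ρ₀, t₀), |z.1 - ρ₀| < 1 := by
      have hc : Continuous fun z : ℝ × ℝ => |z.1 - ρ₀| := by fun_prop
      exact hc.continuousAt.eventually_lt continuousAt_const (by simp)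
    filter_upwards [this] with z hz
    exact Eventually.of_forall fun σ => h.shift_bd (by linarith) ρ₀ z.1 _ σ hz.le
  · exact ((integrable_jap_sub hk ρ₀).const_mul _).integrableOn
  · exact Eventually.of_forall fun σ =>
      (h.cont2 (by fun_prop) (by fun_prop)).continuousAt

/-- Constant in the bound for `Iop`. -/
def C1 (k d : ℝ) : ℝ := 2 ^ (k - 1) / (k - 1) + 3 ^ k * (cJ (d - k) + cJ k)

lemma C1_nonneg (hk : 1 < k) : 0 ≤ C1 k d := by
  have := cJ_nonneg (d - k)
  have := cJ_nonneg k
  have : 0 < k - 1 := by linarith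
  unfold C1; positivity

lemma Src.Iop_bd (h : Src k d A G) (hk : 1 < k) (hd : k + 1 < d) (ρ : ℝ) {t : ℝ} (ht : 0 ≤ t) :
    |Iop G ρ t| ≤ A * C1 k d * wB k |ρ| t := by
  have hA := h.A_nonneg
  have c1 := cJ_nonneg (d - k)
  have c2 := cJ_nonneg k
  have hk1 : 0 < k - 1 := by linarith
  have hB : 0 ≤ wB k |ρ| t := wB_nonneg (abs_nonneg _) ht
  rcases le_total 0 ρ with hρ | hρ
  · rw [abs_of_nonneg hρ] at hB ⊢
    have hX : 0 < 1 + ρ + t := by linarith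
    set g : ℝ → ℝ := fun s => A * (3 ^ k * (1 + ρ + t) ^ (-k) *
      ((1 + |(ρ - t) - 2 * s|) ^ (-(d - k)) + (1 + |s - ρ|) ^ (-k))) with hg
    have hgi : Integrable g :=
      (((integrable_jap_two (by linarith) _).add (integrable_jap_sub hk ρ)).const_mul _).const_mul _
    have hg0 : ∀ s, 0 ≤ g s := fun s => by simp only [hg]; positivity
    have s1 : |Iop G ρ t| ≤ ∫ s in Ioi (0:ℝ), g s := by
      rw [← Real.norm_eq_abs]
      refine norm_integral_le_of_norm_le hgi.integrableOn ?_
      refine (ae_restrict_iff' measurableSet_Ioi).2 (Eventually.of_forall fun s hs => ?_)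
      have hs : 0 < s := hs
      refine (h.bd _ _ (by linarith)).trans ?_
      exact mul_le_mul_of_nonneg_left (wt_in (by linarith) (by linarith) hρ ht hs.le) hA
    have s2 : ∫ s in Ioi (0:ℝ), g s ≤ ∫ s, g s :=
      setIntegral_le_integral hgi (Eventually.of_forall hg0)
    have s3 : ∫ s, g s ≤ A * (3 ^ k * (1 + ρ + t) ^ (-k) * (cJ (d - k) + cJ k)) := by
      simp only [hg]
      rw [integral_const_mul, integral_const_mul,
        integral_add (integrable_jap_two (by linarith) _) (integrable_jap_sub hk ρ),
        integral_jap_sub]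
      have := integral_jap_two (d - k) (ρ - t)
      gcongr
    have s4 := X_le_wB hk hρ ht
    calc |Iop G ρ t| ≤ A * (3 ^ k * (1 + ρ + t) ^ (-k) * (cJ (d - k) + cJ k)) :=
          s1.trans (s2.trans s3)
      _ ≤ A * (3 ^ k * wB k ρ t * (cJ (d - k) + cJ k)) := by gcongr
      _ ≤ A * C1 k d * wB k ρ t := by
          have : 0 ≤ A * wB k ρ t * (2 ^ (k - 1) / (k - 1)) := by positivity
          unfold C1
          nlinarith
  · obtain ⟨r, rfl⟩ : ∃ r, ρ = -r := ⟨-ρ, by ring⟩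
    have hr : 0 ≤ r := by linarith
    rw [abs_neg, abs_of_nonneg hr] at hB ⊢
    set g : ℝ → ℝ := fun s => A * ((s + (1 + r)) ^ (-k) * (1 + |r - t|) ^ (-d)) with hg
    have hgi : IntegrableOn g (Ioi 0) :=
      ((integrableOn_shift hk (by linarith)).mul_const _).const_mul _
    have s1 : |Iop G (-r) t| ≤ ∫ s in Ioi (0:ℝ), g s := by
      rw [← Real.norm_eq_abs]
      refine norm_integral_le_of_norm_le hgi ?_
      refine (ae_restrict_iff' measurableSet_Ioi).2 (Eventually.of_forall fun s hs => ?_)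
      have hs : 0 < s := hs
      refine (h.bd _ _ (by linarith)).trans ?_
      rw [wt_out hr hs.le]
    have s3 : ∫ s in Ioi (0:ℝ), g s =
        A * ((1 + r) ^ (-(k - 1)) / (k - 1) * (1 + |r - t|) ^ (-d)) := by
      simp only [hg]
      rw [integral_const_mul, integral_mul_const, integral_shift hk (by linarith)]
    have s4 := out_le_wB (d := d) hk (by linarith) hr ht
    rw [s3] at s1
    calc |Iop G (-r) t| ≤ A / (k - 1) * ((1 + r) ^ (-(k - 1)) * (1 + |r - t|) ^ (-d)) := by
          refine s1.trans (le_of_eq ?_); ring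
      _ ≤ A / (k - 1) * (2 ^ (k - 1) * wB k r t) := by gcongr
      _ ≤ A * C1 k d * wB k r t := by
          have : 0 ≤ A * wB k r t * (3 ^ k * (cJ (d - k) + cJ k)) := by positivity
          unfold C1
          have e : A / (k - 1) * (2 ^ (k - 1) * wB k r t) =
            A * (2 ^ (k - 1) / (k - 1)) * wB k r t := by ring
          rw [e]
          nlinarith

lemma Src.Iop_dr (h : Src k d A G) (hl : Src k d A Gl) (hk : 1 < k)
    (hd : ∀ l s, HasDerivAt (fun l => G l s) (Gl l s) l) (ρ t : ℝ) :
    HasDerivAt (fun ρ => Iop G ρ t) (-Iop Gl ρ t) ρ := by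
  have := hasDerivAt_integral_of_dominated_loc_of_deriv_le
    (μ := volume.restrict (Ioi (0:ℝ))) (x₀ := ρ) (s := Metric.ball ρ 1)
    (F := fun ρ σ => G (σ - ρ) (σ + t)) (F' := fun ρ σ => -Gl (σ - ρ) (σ + t))
    (bound := fun σ => A * 2 ^ k * (1 + |σ - ρ|) ^ (-k))
    (Metric.ball_mem_nhds _ one_pos)
    (Eventually.of_forall fun z => (h.cont2 (by fun_prop) (by fun_prop)).aestronglyMeasurable)
    (h.integrable hk ρ t)
    ((hl.cont2 (by fun_prop) (by fun_prop)).neg.aestronglyMeasurable)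
    (Eventually.of_forall fun σ x hx => by
      rw [norm_neg]
      refine hl.shift_bd (by linarith) ρ x _ σ ?_
      rw [Metric.mem_ball, Real.dist_eq] at hx
      exact hx.le)
    (((integrable_jap_sub hk ρ).const_mul _).integrableOn)
    (Eventually.of_forall fun σ x hx => by
      have h1 : HasDerivAt (fun x : ℝ => σ - x) (-1) x := by
        simpa using (hasDerivAt_id x).const_sub σ
      have := (hd (σ - x) (σ + t)).comp x h1
      rw [mul_neg_one] at this
      exact this)
  have h2 := this.2
  rw [integral_neg] at h2
  exact h2

lemma Src.Iop_dt (h : Src k d A G) (hs : Src k d A Gs) (hk : 1 < k)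
    (hd : ∀ l s, 0 < s → HasDerivAt (fun s => G l s) (Gs l s) s) (ρ : ℝ) {t : ℝ} (ht : 0 < t) :
    HasDerivAt (fun t => Iop G ρ t) (Iop Gs ρ t) t := by
  have := hasDerivAt_integral_of_dominated_loc_of_deriv_le
    (μ := volume.restrict (Ioi (0:ℝ))) (x₀ := t) (s := Ioi 0)
    (F := fun t σ => G (σ - ρ) (σ + t)) (F' := fun t σ => Gs (σ - ρ) (σ + t))
    (bound := fun σ => A * 2 ^ k * (1 + |σ - ρ|) ^ (-k))
    (Ioi_mem_nhds ht)
    (Eventually.of_forall fun z => (h.cont2 (by fun_prop) (by fun_prop)).aestronglyMeasurable)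
    (h.integrable hk ρ t)
    ((hs.cont2 (by fun_prop) (by fun_prop)).aestronglyMeasurable)
    (Eventually.of_forall fun σ x hx => hs.shift_bd (by linarith) ρ ρ _ σ (by simp))
    (((integrable_jap_sub hk ρ).const_mul _).integrableOn)
    ((ae_restrict_iff' measurableSet_Ioi).2 (Eventually.of_forall fun σ hσ x hx => by
      have hσ : 0 < σ := hσ
      have hx : 0 < x := hx
      have h1 : HasDerivAt (fun x : ℝ => σ + x) 1 x := by
        simpa using (hasDerivAt_id x).const_add σ
      have := (hd (σ - ρ) (σ + x) (by linarith)).comp x h1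
      rw [mul_one] at this
      exact this))
  exact this.2

/-- Total derivative along characteristics. -/
lemma Src.diag (hl : Src k d A Gl) (hs : Src k d A Gs)
    (hdl : ∀ l s, HasDerivAt (fun l => G l s) (Gl l s) l)
    (hds : ∀ l s, 0 < s → HasDerivAt (fun s => G l s) (Gs l s) s) (ρ t σ : ℝ) (h0 : 0 < σ + t) :
    HasDerivAt (fun σ => G (σ - ρ) (σ + t))
      (Gl (σ - ρ) (σ + t) + Gs (σ - ρ) (σ + t)) σ := by
  have key := hasStrictFDerivAt_uncurry_coprod (𝕜 := ℝ) (u := ((σ - ρ, σ + t) : ℝ × ℝ)) (f := G)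
    (f₁ := fun l s => ContinuousLinearMap.toSpanSingleton ℝ (Gl l s))
    (f₂ := fun l s => ContinuousLinearMap.toSpanSingleton ℝ (Gs l s))
    (Eventually.of_forall fun v => (hdl v.1 v.2).hasFDerivAt)
    (by
      have : ∀ᶠ v : ℝ × ℝ in 𝓝 (σ - ρ, σ + t), 0 < v.2 :=
        continuousAt_const.eventually_lt continuousAt_snd h0
      filter_upwards [this] with v hv
      exact (hds v.1 v.2 hv).hasFDerivAt)
    (by
      have : Continuous fun v : ℝ × ℝ => ContinuousLinearMap.toSpanSingletonCLE (𝕜 := ℝ) (E := ℝ)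
        (Gl v.1 v.2) := (ContinuousLinearMap.toSpanSingletonCLE).continuous.comp
          (hl.cont2 continuous_fst continuous_snd)
      exact this.continuousAt)
    (by
      have : Continuous fun v : ℝ × ℝ => ContinuousLinearMap.toSpanSingletonCLE (𝕜 := ℝ) (E := ℝ)
        (Gs v.1 v.2) := (ContinuousLinearMap.toSpanSingletonCLE).continuous.comp
          (hs.cont2 continuous_fst continuous_snd)
      exact this.continuousAt)
  have hc : HasDerivAt (fun σ : ℝ => ((σ - ρ, σ + t) : ℝ × ℝ)) (1, 1) σ :=
    ((hasDerivAt_id σ).sub_const ρ).prodMk ((hasDerivAt_id σ).add_const t)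
  have := key.hasFDerivAt.comp_hasDerivAt σ hc
  have e : ((ContinuousLinearMap.toSpanSingleton ℝ (Gl (σ - ρ) (σ + t))).coprod
      (ContinuousLinearMap.toSpanSingleton ℝ (Gs (σ - ρ) (σ + t)))) ((1 : ℝ), (1 : ℝ)) =
      Gl (σ - ρ) (σ + t) + Gs (σ - ρ) (σ + t) := by simp
  rw [← e]
  exact this

lemma tendsto_jap (hk : 0 < k) (ρ : ℝ) :
    Tendsto (fun σ : ℝ => (1 + |σ - ρ|) ^ (-k)) atTop (𝓝 0) := by
  have h1 : Tendsto (fun σ : ℝ => 1 + |σ - ρ|) atTop atTop :=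
    tendsto_atTop_add_const_left _ _ (tendsto_abs_atTop_atTop.comp
      (tendsto_atTop_add_const_right _ _ tendsto_id))
  exact (tendsto_rpow_neg_atTop hk).comp h1

lemma Src.Iop_rel (h : Src k d A G) (hl : Src k d A Gl) (hs : Src k d A Gs) (hk : 1 < k)
    (hdl : ∀ l s, HasDerivAt (fun l => G l s) (Gl l s) l)
    (hds : ∀ l s, 0 < s → HasDerivAt (fun s => G l s) (Gs l s) s) (ρ : ℝ) {t : ℝ} (ht : 0 < t) :
    Iop Gl ρ t + Iop Gs ρ t = -G (-ρ) t := by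
  have h1 := integral_Ioi_of_hasDerivAt_of_tendsto' (a := (0:ℝ)) (m := 0)
    (f := fun σ => G (σ - ρ) (σ + t))
    (f' := fun σ => Gl (σ - ρ) (σ + t) + Gs (σ - ρ) (σ + t))
    (fun x hx => hl.diag hs hdl hds ρ t x (by have : 0 ≤ x := hx; linarith))
    ((hl.integrable hk ρ t).add (hs.integrable hk ρ t))
    (by
      refine squeeze_zero_norm (fun σ => h.bd0 _ _) ?_
      simpa using (tendsto_jap (by linarith) ρ).const_mul A)
  rw [integral_add (hl.integrable hk ρ t) (hs.integrable hk ρ t)] at h1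
  simp only [zero_sub, zero_add] at h1
  exact h1

end

end

section

open Real MeasureTheory Filter Set Topology

noncomputable section

/-- Odd `C¹` sources with weighted bounds. -/
structure SrcC1 (k d A : ℝ) (G Gl Gs : ℝ → ℝ → ℝ) : Prop where
  h : Src k d A G
  hl : Src k d A Gl
  hs : Src k d A Gs
  dl : ∀ l s, HasDerivAt (fun l => G l s) (Gl l s) l
  ds : ∀ l s, 0 < s → HasDerivAt (fun s => G l s) (Gs l s) s
  odd : ∀ l s, G (-l) s = -G l s

variable {k d A : ℝ} {G Gl Gs : ℝ → ℝ → ℝ}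

/-- The function `r R(F)`. -/
def Phi (G : ℝ → ℝ → ℝ) (r t : ℝ) : ℝ := (1 / 2) * ∫ ρ in (-r)..r, Iop G ρ t

lemma swap_lemma (h : Src k d A G) (hk : 1 < k) (t : ℝ) {r : ℝ} (hr : 0 ≤ r) :
    ∫ ρ in (-r)..r, Iop G ρ t =
      ∫ σ in Ioi (0:ℝ), ∫ ρ in (-r)..r, G (σ - ρ) (σ + t) := by
  have hle : -r ≤ r := by linarith
  simp only [intervalIntegral.integral_of_le hle, Iop]
  refine integral_integral_swap (f := fun ρ σ => G (σ - ρ) (σ + t)) ?_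
  have hg : Integrable (fun z : ℝ × ℝ => (A * (1 + r) ^ k) * (1 + |z.2|) ^ (-k))
      ((volume.restrict (Ioc (-r) r)).prod (volume.restrict (Ioi 0))) := by
    have h1 : Integrable (fun _ : ℝ => A * (1 + r) ^ k) (volume.restrict (Ioc (-r) r)) :=
      integrable_const _
    exact h1.mul_prod ((integrable_jap hk).integrableOn (s := Ioi (0:ℝ)))
  refine hg.mono' ?_ ?_
  · exact (h.cont2 (by fun_prop) (by fun_prop)).aestronglyMeasurable
  · rw [Measure.prod_restrict]
    refine (ae_restrict_iff' (measurableSet_Ioc.prod measurableSet_Ioi)).2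
      (Eventually.of_forall fun z hz => ?_)
    obtain ⟨⟨hz1, hz2⟩, -⟩ := hz
    refine (h.bd0 _ _).trans ?_
    rw [mul_assoc]
    refine mul_le_mul_of_nonneg_left ?_ h.A_nonneg
    refine rpow_neg_le_of_le_mul (by positivity) (by linarith) (by linarith) ?_
    have h3 : |z.2| ≤ |z.2 - z.1| + |z.1| := by simpa using abs_sub_le z.2 z.1 0
    have h4 : |z.1| ≤ r := abs_le.2 ⟨hz1.le, hz2⟩
    have := abs_nonneg (z.2 - z.1)
    nlinarith

lemma Phi_eq' (h : Src k d A G) (hk : 1 < k) (t : ℝ) {r : ℝ} (hr : 0 ≤ r) :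
    Phi G r t = (1 / 2) * ∫ σ in Ioi (0:ℝ), ∫ l in (σ - r)..(σ + r), G l (σ + t) := by
  rw [Phi, swap_lemma h hk t hr]
  congr 2
  ext σ
  rw [intervalIntegral.integral_comp_sub_left (fun l => G l (σ + t)) σ, sub_neg_eq_add]

lemma Phi_eq (h : Src k d A G) (hk : 1 < k) (t : ℝ) {r : ℝ} (hr : 0 ≤ r) :
    Phi G r t = (1 / 2) * ∫ s in Ioi t, ∫ l in ((s - t) - r)..((s - t) + r), G l s := by
  rw [Phi_eq' h hk t hr]
  have := setIntegral_Ioi_shift (fun s => ∫ l in ((s - t) - r)..((s - t) + r), G l s) 0 t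
  rw [zero_add] at this
  rw [← this]
  simp only [add_sub_cancel_right]

lemma odd_integral {f : ℝ → ℝ} (hf : ∀ x, f (-x) = -f x) (a : ℝ) : ∫ x in (-a)..a, f x = 0 := by
  have h1 := intervalIntegral.integral_comp_neg (a := -a) (b := a) f
  rw [neg_neg] at h1
  simp only [hf, intervalIntegral.integral_neg] at h1
  linarith

lemma SrcC1.inner_abs (H : SrcC1 k d A G Gl Gs) (s σ r : ℝ) :
    ∫ l in (σ - r)..(σ + r), G l s = ∫ l in |σ - r|..(σ + r), G l s := by
  rcases le_total 0 (σ - r) with h | h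
  · rw [abs_of_nonneg h]
  · rw [abs_of_nonpos h]
    have hi : ∀ a b : ℝ, IntervalIntegrable (fun l => G l s) volume a b := fun a b =>
      (H.h.cont2 continuous_id continuous_const).intervalIntegrable a b
    rw [← intervalIntegral.integral_add_adjacent_intervals (hi (σ - r) (-(σ - r))) (hi _ _)]
    have := odd_integral (f := fun l => G l s) (fun x => H.odd x s) (-(σ - r))
    rw [neg_neg] at this
    rw [this, zero_add]

/-- Constant in the direct bound for `Phi`. -/
def C3 (k d : ℝ) : ℝ := 6 ^ k * cJ (d - k) / (k - 1)

lemma C3_nonneg (hk : 1 < k) : 0 ≤ C3 k d := by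
  have := cJ_nonneg (d - k)
  have : 0 < k - 1 := by linarith
  unfold C3; positivity

lemma SrcC1.inner_bd (H : SrcC1 k d A G Gl Gs) (hk : 1 < k) (hd : k + 1 < d)
    {r t σ : ℝ} (hr : 0 ≤ r) (ht : 0 ≤ t) (hσ : 0 ≤ σ) :
    |∫ l in (σ - r)..(σ + r), G l (σ + t)| ≤
      A * 6 ^ k * cJ (d - k) * (σ + (1 + r + t)) ^ (-k) := by
  have hA := H.h.A_nonneg
  rw [H.inner_abs]
  have hab : |σ - r| ≤ σ + r := by rw [abs_le]; constructor <;> linarith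
  have hX : 0 < σ + (1 + r + t) := by linarith
  set g : ℝ → ℝ := fun l => A * (6 ^ k * (σ + (1 + r + t)) ^ (-k) *
    (1 + |l - (σ + t)|) ^ (-(d - k))) with hg
  have hgi : Integrable g := ((integrable_jap_sub (by linarith) _).const_mul _).const_mul _
  have hg0 : ∀ s, 0 ≤ g s := fun s => by simp only [hg]; positivity
  have s1 : |∫ l in |σ - r|..(σ + r), G l (σ + t)| ≤ ∫ l in |σ - r|..(σ + r), g l := by
    rw [← Real.norm_eq_abs]
    refine intervalIntegral.norm_integral_le_of_norm_le hab ?_ hgi.intervalIntegrable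
    refine Eventually.of_forall fun l hl => ?_
    refine (H.h.bd _ _ (by linarith)).trans ?_
    refine mul_le_mul_of_nonneg_left ?_ hA
    have hl0 : 0 ≤ l := (abs_nonneg _).trans hl.1.le
    have hl1 := hl.1
    unfold wt
    rw [abs_of_nonneg hl0]
    refine prod_rpow_le hX (by linarith) (by positivity) (by norm_num) (by linarith) ?_
    have e1 := le_abs_self (σ - r)
    have e2 := neg_abs_le (σ - r)
    have e3 := abs_nonneg (l - (σ + t))
    have e4 := neg_abs_le (l - (σ + t))
    nlinarith
  have s2 : ∫ l in |σ - r|..(σ + r), g l ≤ ∫ l, g l := by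
    rw [intervalIntegral.integral_of_le hab]
    exact setIntegral_le_integral hgi (Eventually.of_forall hg0)
  have s3 : ∫ l, g l = A * (6 ^ k * (σ + (1 + r + t)) ^ (-k) * cJ (d - k)) := by
    simp only [hg]
    rw [integral_const_mul, integral_const_mul, integral_jap_sub]
  rw [s3] at s2
  refine s1.trans (s2.trans (le_of_eq ?_))
  ring

lemma SrcC1.Phi_direct (H : SrcC1 k d A G Gl Gs) (hk : 1 < k) (hd : k + 1 < d)
    {r t : ℝ} (hr : 0 ≤ r) (ht : 0 ≤ t) :
    |Phi G r t| ≤ A * C3 k d * (1 + r + t) ^ (-(k - 1)) := by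
  have hA := H.h.A_nonneg
  have hc := cJ_nonneg (d - k)
  have hk1 : 0 < k - 1 := by linarith
  have hX : 0 < 1 + r + t := by linarith
  rw [Phi_eq' H.h hk t hr, abs_mul, abs_of_pos (by norm_num : (0:ℝ) < 1 / 2)]
  have s1 : |∫ σ in Ioi (0:ℝ), ∫ l in (σ - r)..(σ + r), G l (σ + t)| ≤
      ∫ σ in Ioi (0:ℝ), A * 6 ^ k * cJ (d - k) * (σ + (1 + r + t)) ^ (-k) := by
    rw [← Real.norm_eq_abs]
    refine norm_integral_le_of_norm_le ((integrableOn_shift hk hX).const_mul _) ?_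
    refine (ae_restrict_iff' measurableSet_Ioi).2 (Eventually.of_forall fun s hs => ?_)
    have hs : 0 < s := hs
    exact H.inner_bd hk hd hr ht hs.le
  rw [integral_const_mul, integral_shift hk hX] at s1
  have e : A * 6 ^ k * cJ (d - k) * ((1 + r + t) ^ (-(k - 1)) / (k - 1)) =
      A * C3 k d * (1 + r + t) ^ (-(k - 1)) := by unfold C3; ring
  rw [e] at s1
  have := abs_nonneg (∫ σ in Ioi (0:ℝ), ∫ l in (σ - r)..(σ + r), G l (σ + t))
  linarith

/-- Right derivative from derivatives in the open half line and continuity. -/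
lemma oneside {f g : ℝ → ℝ} (hf : Continuous f) (hg : Continuous g)
    (h : ∀ t, 0 < t → HasDerivAt f (g t) t) {t : ℝ} (ht : 0 ≤ t) :
    HasDerivWithinAt f (g t) (Ici 0) t := by
  rcases ht.eq_or_lt with rfl | ht
  · refine hasDerivWithinAt_Ici_of_tendsto_deriv (s := Ioi 0)
      (fun x hx => (h x hx).differentiableAt.differentiableWithinAt) hf.continuousWithinAt
      self_mem_nhdsWithin ?_
    have : Tendsto g (𝓝[>] 0) (𝓝 (g 0)) := hg.continuousWithinAt
    refine this.congr' ?_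
    filter_upwards [self_mem_nhdsWithin] with x hx
    exact (h x hx).deriv.symm
  · exact (h t ht).hasDerivWithinAt

lemma SrcC1.aux_cont (h : Src k d A G) (hk : 1 < k) {X : Type*} [TopologicalSpace X] {f g : X → ℝ}
    (hf : Continuous f) (hg : Continuous g) : Continuous (fun x => Iop G (f x) (g x)) :=
  (h.Iop_cont hk).comp (hf.prodMk hg)

lemma SrcC1.Phi_dr (H : SrcC1 k d A G Gl Gs) (hk : 1 < k) (r t : ℝ) :
    HasDerivAt (fun r => Phi G r t) ((Iop G r t + Iop G (-r) t) / 2) r := by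
  have hc : Continuous (fun ρ => Iop G ρ t) := aux_cont H.h hk continuous_id continuous_const
  have h1 : ∀ x, HasDerivAt (fun r => ∫ ρ in (0:ℝ)..r, Iop G ρ t) (Iop G x t) x := fun x =>
    intervalIntegral.integral_hasDerivAt_right (hc.intervalIntegrable _ _)
      (hc.stronglyMeasurableAtFilter _ _) hc.continuousAt
  have h2 : HasDerivAt (fun r => ∫ ρ in (0:ℝ)..(-r), Iop G ρ t) (Iop G (-r) t * -1) r :=
    (h1 (-r)).comp r (hasDerivAt_neg r)
  have h3 := ((h1 r).sub h2).const_mul (1 / 2 : ℝ)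
  have e : (fun r => Phi G r t) = fun r => (1 / 2 : ℝ) * ((∫ ρ in (0:ℝ)..r, Iop G ρ t) -
      ∫ ρ in (0:ℝ)..(-r), Iop G ρ t) := by
    ext x
    rw [Phi, intervalIntegral.integral_interval_sub_left (hc.intervalIntegrable _ _)
      (hc.intervalIntegrable _ _)]
  rw [e]
  have e2 : (Iop G r t + Iop G (-r) t) / 2 = 1 / 2 * (Iop G r t - Iop G (-r) t * -1) := by ring
  rw [e2]
  exact h3

lemma SrcC1.Phi_dt_pos (H : SrcC1 k d A G Gl Gs) (hk : 1 < k) (hd : k + 1 < d)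
    (r : ℝ) {t : ℝ} (ht : 0 < t) :
    HasDerivAt (fun t => Phi G r t) ((Iop G r t - Iop G (-r) t) / 2) t := by
  have hcs : ∀ t, Continuous (fun ρ => Iop Gs ρ t) := fun t =>
    aux_cont H.hs hk continuous_id continuous_const
  have hc : ∀ t, Continuous (fun ρ => Iop G ρ t) := fun t =>
    aux_cont H.h hk continuous_id continuous_const
  have h1 := intervalIntegral.hasDerivAt_integral_of_dominated_loc_of_deriv_le
    (μ := volume) (a := -r) (b := r) (x₀ := t) (s := Ioi 0)
    (F := fun t ρ => Iop G ρ t) (F' := fun t ρ => Iop Gs ρ t)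
    (bound := fun _ => A * C1 k d * 1)
    (Ioi_mem_nhds ht)
    (Eventually.of_forall fun t => (hc t).aestronglyMeasurable)
    ((hc t).intervalIntegrable _ _)
    ((hcs t).aestronglyMeasurable)
    (Eventually.of_forall fun ρ _ x hx => by
      have hx : 0 < x := hx
      refine (H.hs.Iop_bd hk hd ρ hx.le).trans ?_
      refine mul_le_mul_of_nonneg_left ?_ (mul_nonneg H.h.A_nonneg (C1_nonneg hk))
      unfold wB
      have e1 : (1 + |ρ| + x) ^ (-(k - 1)) ≤ 1 :=
        Real.rpow_le_one_of_one_le_of_nonpos (by linarith [abs_nonneg ρ]) (by linarith)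
      have e2 : (1 + |(|ρ| - x)|)⁻¹ ≤ 1 := inv_le_one_of_one_le₀ (one_le_w _)
      exact mul_le_one₀ e1 (by positivity) e2)
    (by simp)
    (Eventually.of_forall fun ρ _ x hx => H.h.Iop_dt H.hs hk H.ds ρ hx)
  have h2 := h1.2.const_mul (1 / 2 : ℝ)
  have e : ∫ ρ in (-r)..r, Iop Gs ρ t = Iop G r t - Iop G (-r) t := by
    have e1 : ∀ ρ, Iop Gs ρ t = -Iop Gl ρ t + G ρ t := fun ρ => by
      have := H.h.Iop_rel H.hl H.hs hk H.dl H.ds ρ ht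
      rw [H.odd] at this
      linarith
    have c1 : Continuous (fun ρ => -Iop Gl ρ t) :=
      (aux_cont H.hl hk continuous_id continuous_const).neg
    have c2 : Continuous (fun ρ => G ρ t) := H.h.cont2 continuous_id continuous_const
    simp only [e1]
    rw [intervalIntegral.integral_add (c1.intervalIntegrable _ _) (c2.intervalIntegrable _ _),
      odd_integral (f := fun ρ => G ρ t) (fun x => H.odd x t), add_zero]
    exact intervalIntegral.integral_eq_sub_of_hasDerivAt
      (fun x _ => H.h.Iop_dr H.hl hk H.dl x t) (c1.intervalIntegrable _ _)
  rw [e] at h2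
  have e2 : (Iop G r t - Iop G (-r) t) / 2 = 1 / 2 * (Iop G r t - Iop G (-r) t) := by ring
  rw [e2]
  exact h2

lemma SrcC1.Phi_dt (H : SrcC1 k d A G Gl Gs) (hk : 1 < k) (hd : k + 1 < d)
    (r : ℝ) {t : ℝ} (ht : 0 ≤ t) :
    HasDerivWithinAt (fun t => Phi G r t) ((Iop G r t - Iop G (-r) t) / 2) (Ici 0) t := by
  refine oneside (f := fun t => Phi G r t) (g := fun t => (Iop G r t - Iop G (-r) t) / 2)
    ?_ ?_ (fun t ht => H.Phi_dt_pos hk hd r ht) ht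
  · unfold Phi
    refine continuous_const.mul ?_
    exact intervalIntegral.continuous_parametric_intervalIntegral_of_continuous'
      (f := fun t ρ => Iop G ρ t) (aux_cont H.h hk continuous_snd continuous_fst) _ _
  · exact ((aux_cont H.h hk continuous_const continuous_id).sub
      (aux_cont H.h hk continuous_const continuous_id)).div_const _

lemma SrcC1.neg_dr (H : SrcC1 k d A G Gl Gs) (hk : 1 < k) (r t : ℝ) :
    HasDerivAt (fun r => Iop G (-r) t) (Iop Gl (-r) t) r := by
  have := (H.h.Iop_dr H.hl hk H.dl (-r) t).comp r (hasDerivAt_neg r)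
  rw [neg_mul_neg, mul_one] at this
  exact this

lemma SrcC1.Phi_drr (H : SrcC1 k d A G Gl Gs) (hk : 1 < k) (r t : ℝ) :
    HasDerivAt (fun r => (Iop G r t + Iop G (-r) t) / 2)
      ((-Iop Gl r t + Iop Gl (-r) t) / 2) r :=
  ((H.h.Iop_dr H.hl hk H.dl r t).add (H.neg_dr hk r t)).div_const 2

lemma SrcC1.Phi_drt (H : SrcC1 k d A G Gl Gs) (hk : 1 < k) (r t : ℝ) :
    HasDerivAt (fun r => (Iop G r t - Iop G (-r) t) / 2)
      ((-Iop Gl r t - Iop Gl (-r) t) / 2) r :=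
  ((H.h.Iop_dr H.hl hk H.dl r t).sub (H.neg_dr hk r t)).div_const 2

lemma SrcC1.Iop_dt0 (H : SrcC1 k d A G Gl Gs) (hk : 1 < k) (ρ : ℝ) {t : ℝ} (ht : 0 ≤ t) :
    HasDerivWithinAt (fun t => Iop G ρ t) (Iop Gs ρ t) (Ici 0) t :=
  oneside (f := fun t => Iop G ρ t) (g := fun t => Iop Gs ρ t)
    (aux_cont H.h hk continuous_const continuous_id)
    (aux_cont H.hs hk continuous_const continuous_id)
    (fun _ ht => H.h.Iop_dt H.hs hk H.ds ρ ht) ht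

lemma SrcC1.Phi_dtt (H : SrcC1 k d A G Gl Gs) (hk : 1 < k) (r : ℝ) {t : ℝ} (ht : 0 ≤ t) :
    HasDerivWithinAt (fun t => (Iop G r t - Iop G (-r) t) / 2)
      ((Iop Gs r t - Iop Gs (-r) t) / 2) (Ici 0) t :=
  ((H.Iop_dt0 hk r ht).sub (H.Iop_dt0 hk (-r) ht)).div_const 2

end

end

section

open Real MeasureTheory Filter Set Topology

noncomputable section

variable {k d A : ℝ} {G Gl Gs : ℝ → ℝ → ℝ}

lemma wB_near {k r ρ t : ℝ} (hk : 1 < k) (hρ : 0 ≤ ρ) (hρr : ρ ≤ r) (ht : 0 ≤ t)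
    (h : r ≤ t ∨ r ≤ 1) : wB k ρ t ≤ 2 ^ k * wB k r t := by
  have hr : 0 ≤ r := hρ.trans hρr
  have e1 : (1 + ρ + t) ^ (-(k - 1)) ≤ 2 ^ (k - 1) * (1 + r + t) ^ (-(k - 1)) := by
    refine rpow_neg_le_of_le_mul (by positivity) (by norm_num) (by linarith) ?_
    rcases h with h | h <;> linarith
  have e2 : (1 + |ρ - t|)⁻¹ ≤ 2 * (1 + |r - t|)⁻¹ := by
    rw [← div_eq_mul_inv, inv_eq_one_div, div_le_div_iff₀ (by positivity) (by positivity)]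
    rcases h with h | h
    · rw [abs_of_nonpos (by linarith), abs_of_nonpos (by linarith)]; linarith
    · have : |r - t| ≤ |r - ρ| + |ρ - t| := abs_sub_le _ _ _
      rw [abs_of_nonneg (show 0 ≤ r - ρ by linarith)] at this
      have := abs_nonneg (ρ - t)
      linarith
  have e3 : (2:ℝ) ^ k = 2 ^ (k - 1) * 2 := by
    rw [← Real.rpow_add_one (by norm_num)]; congr 1; ring
  unfold wB
  calc _ ≤ (2 ^ (k - 1) * (1 + r + t) ^ (-(k - 1))) * (2 * (1 + |r - t|)⁻¹) :=
        mul_le_mul e1 e2 (by positivity) (by positivity)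
    _ = _ := by rw [e3]; ring

/-- The majorant of `bracket2` in terms of the derivative values. -/
def maj (r v a b ar br bt : ℝ) : ℝ :=
  |v| + (1 + r) * (|a| + |b|) + r * (|ar| + |br| + |bt|)

lemma maj_alg {r V Vr Vt Vrr Vrt Vtt M : ℝ} (hr : 0 < r)
    (h0 : |V| ≤ r * M) (h1 : |Vr| ≤ M) (h2 : |Vt| ≤ M) (h3 : |Vrr| ≤ M) (h4 : |Vrt| ≤ M)
    (h5 : |Vtt| ≤ M) (h6 : r ≤ 1 → |Vt| ≤ r * M) (h7 : r ≤ 1 → |r * Vr - V| ≤ r ^ 2 * M) :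
    maj r (V / r) (Vr / r - V / r ^ 2) (Vt / r) (Vrr / r - 2 * Vr / r ^ 2 + 2 * V / r ^ 3)
      (Vrt / r - Vt / r ^ 2) (Vtt / r) ≤ 20 * M := by
  have hM : 0 ≤ M := (abs_nonneg _).trans h1
  have b0 : |V / r| ≤ M := by
    rw [abs_div, abs_of_pos hr, div_le_iff₀ hr]; linarith
  have b1 : (1 + r) * |Vr / r - V / r ^ 2| ≤ 4 * M := by
    rcases le_total r 1 with h | h
    · have e : Vr / r - V / r ^ 2 = (r * Vr - V) / r ^ 2 := by field_simp
      have : |Vr / r - V / r ^ 2| ≤ M := by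
        rw [e, abs_div, abs_of_pos (show 0 < r ^ 2 by positivity), div_le_iff₀ (by positivity)]
        linarith [h7 h]
      have := abs_nonneg (Vr / r - V / r ^ 2)
      nlinarith
    · have e : Vr / r - V / r ^ 2 = (Vr - V / r) / r := by field_simp
      have e2 : |Vr - V / r| ≤ 2 * M := (abs_sub _ _).trans (by linarith)
      rw [e, abs_div, abs_of_pos hr, mul_div_assoc', div_le_iff₀ hr]
      nlinarith [abs_nonneg (Vr - V / r)]
  have b2 : (1 + r) * |Vt / r| ≤ 2 * M := by
    rw [abs_div, abs_of_pos hr, mul_div_assoc', div_le_iff₀ hr]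
    rcases le_total r 1 with h | h
    · have := h6 h
      nlinarith [abs_nonneg Vt]
    · nlinarith [abs_nonneg Vt]
  have a1 : |Vr / r - V / r ^ 2| ≤ 4 * M := by nlinarith [abs_nonneg (Vr / r - V / r ^ 2)]
  have a2 : |Vt / r| ≤ 2 * M := by nlinarith [abs_nonneg (Vt / r)]
  have b3 : r * |Vrr / r - 2 * Vr / r ^ 2 + 2 * V / r ^ 3| ≤ 9 * M := by
    have e : r * |Vrr / r - 2 * Vr / r ^ 2 + 2 * V / r ^ 3| =
        |Vrr - 2 * (Vr / r - V / r ^ 2)| := by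
      nth_rewrite 1 [← abs_of_pos hr]
      rw [← abs_mul]; congr 1; field_simp; ring
    rw [e]
    refine (abs_sub _ _).trans ?_
    rw [abs_mul, abs_of_pos (by norm_num : (0:ℝ) < 2)]
    linarith
  have b4 : r * |Vrt / r - Vt / r ^ 2| ≤ 3 * M := by
    have e : r * |Vrt / r - Vt / r ^ 2| = |Vrt - Vt / r| := by
      nth_rewrite 1 [← abs_of_pos hr]
      rw [← abs_mul]; congr 1; field_simp
    rw [e]
    refine (abs_sub _ _).trans ?_
    linarith
  have b5 : r * |Vtt / r| ≤ M := by
    rw [abs_div, abs_of_pos hr, mul_div_cancel₀ _ hr.ne']; exact h5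
  unfold maj
  nlinarith

lemma mvt0 {f f' : ℝ → ℝ} {r M : ℝ} (hr : 0 ≤ r) (h : ∀ x, HasDerivAt f (f' x) x) (h0 : f 0 = 0)
    (hb : ∀ x, 0 ≤ x → x ≤ r → |f' x| ≤ M) : |f r| ≤ M * r := by
  have := norm_image_sub_le_of_norm_deriv_le_segment' (f := f) (f' := f') (a := 0) (b := r)
    (C := M) (fun x _ => (h x).hasDerivWithinAt) (fun x hx => hb x hx.1 hx.2.le) r ⟨hr, le_rfl⟩
  simpa [h0] using this

/-- Final constant of the linear estimate. -/
def C2 (k d : ℝ) : ℝ := 20 * (2 ^ k * C1 k d + 2 * C3 k d)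

lemma C2_nonneg (hk : 1 < k) : 0 ≤ C2 k d := by
  have := C1_nonneg (d := d) hk
  have := C3_nonneg (d := d) hk
  unfold C2; positivity

lemma SrcC1.maj_bd (H : SrcC1 k d A G Gl Gs) (hk : 1 < k) (hd : k + 1 < d)
    {r t V Vr Vt Vrr Vrt Vtt : ℝ} (hr : 0 < r) (ht : 0 ≤ t)
    (eV : V = Phi G r t) (eVr : Vr = (Iop G r t + Iop G (-r) t) / 2)
    (eVt : Vt = (Iop G r t - Iop G (-r) t) / 2)
    (eVrr : Vrr = (-Iop Gl r t + Iop Gl (-r) t) / 2)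
    (eVrt : Vrt = (-Iop Gl r t - Iop Gl (-r) t) / 2)
    (eVtt : Vtt = (Iop Gs r t - Iop Gs (-r) t) / 2) :
    maj r (V / r) (Vr / r - V / r ^ 2) (Vt / r) (Vrr / r - 2 * Vr / r ^ 2 + 2 * V / r ^ 3)
      (Vrt / r - Vt / r ^ 2) (Vtt / r) ≤ C2 k d * A * wB k r t := by
  have hA := H.h.A_nonneg
  have c1 := C1_nonneg (d := d) hk
  have c3 := C3_nonneg (d := d) hk
  have hB := wB_nonneg (k := k) hr.le ht
  have two : (1:ℝ) ≤ 2 ^ k := Real.one_le_rpow (by norm_num) (by linarith)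
  set N := A * C1 k d * wB k r t with hN
  have hN0 : 0 ≤ N := by positivity
  set M := (2 ^ k * C1 k d + 2 * C3 k d) * A * wB k r t with hM
  have hNM : 2 ^ k * N ≤ M := by
    have : M = 2 ^ k * N + 2 * C3 k d * A * wB k r t := by rw [hM, hN]; ring
    have : 0 ≤ 2 * C3 k d * A * wB k r t := by positivity
    linarith
  have hNM' : N ≤ M := by nlinarith
  have hM0 : 0 ≤ M := hN0.trans hNM'
  have half : ∀ x y z : ℝ, |x| ≤ z → |y| ≤ z → |(x + y) / 2| ≤ z := fun x y z hx hy => by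
    rw [abs_le] at *; constructor <;> linarith
  have half' : ∀ x y z : ℝ, |x| ≤ z → |y| ≤ z → |(x - y) / 2| ≤ z := fun x y z hx hy => by
    rw [abs_le] at *; constructor <;> linarith
  have bd : ∀ {F}, Src k d A F → ∀ ρ, 0 ≤ ρ → |Iop F ρ t| ≤ A * C1 k d * wB k ρ t ∧
      |Iop F (-ρ) t| ≤ A * C1 k d * wB k ρ t := fun {F} hF ρ hρ => by
    have h1 := hF.Iop_bd hk hd ρ ht
    have h2 := hF.Iop_bd hk hd (-ρ) ht
    rw [abs_neg] at h2
    rw [abs_of_nonneg hρ] at h1 h2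
    exact ⟨h1, h2⟩
  have near : (r ≤ t ∨ r ≤ 1) → ∀ ρ, 0 ≤ ρ → ρ ≤ r → A * C1 k d * wB k ρ t ≤ M :=
    fun h ρ h0 h1 => by
      refine le_trans ?_ hNM
      have := wB_near hk h0 h1 ht h
      calc _ ≤ A * C1 k d * (2 ^ k * wB k r t) := mul_le_mul_of_nonneg_left this (by positivity)
        _ = _ := by rw [hN]; ring
  have hG := fun ρ hρ => bd H.h ρ hρ
  have hGl := fun ρ hρ => bd H.hl ρ hρ
  have hGs := fun ρ hρ => bd H.hs ρ hρ
  have P0 : Phi G 0 t = 0 := by simp [Phi]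
  have res : maj r (V / r) (Vr / r - V / r ^ 2) (Vt / r) (Vrr / r - 2 * Vr / r ^ 2 + 2 * V / r ^ 3)
      (Vrt / r - Vt / r ^ 2) (Vtt / r) ≤ 20 * M := by
    apply maj_alg hr
    · by_cases h : r ≤ t ∨ r ≤ 1
      · have := mvt0 (M := M) hr.le (fun x => H.Phi_dr hk x t) P0 (fun x h0 h1 =>
          half _ _ _ ((hG x h0).1.trans (near h x h0 h1)) ((hG x h0).2.trans (near h x h0 h1)))
        rw [eV]; linarith
      · push Not at h
        have h1 := H.Phi_direct hk hd hr.le ht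
        rw [eV]
        refine h1.trans ?_
        have e : (1 + r + t) ^ (-(k - 1)) = wB k r t * (1 + |r - t|) := by
          unfold wB; field_simp
        rw [e, abs_of_pos (by linarith)]
        have : A * C3 k d * wB k r t * (1 + (r - t)) ≤ A * C3 k d * wB k r t * (2 * r) :=
          mul_le_mul_of_nonneg_left (by linarith) (by positivity)
        have : 0 ≤ r * (2 ^ k * N) := by positivity
        have : r * M = r * (2 ^ k * N) + A * C3 k d * wB k r t * (2 * r) := by rw [hM, hN]; ring
        nlinarith
    · rw [eVr]; exact half _ _ _ ((hG r hr.le).1.trans hNM') ((hG r hr.le).2.trans hNM')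
    · rw [eVt]; exact half' _ _ _ ((hG r hr.le).1.trans hNM') ((hG r hr.le).2.trans hNM')
    · rw [eVrr]
      exact half _ _ _ ((abs_neg _).trans_le ((hGl r hr.le).1.trans hNM'))
        ((hGl r hr.le).2.trans hNM')
    · rw [eVrt]
      exact half' _ _ _ ((abs_neg _).trans_le ((hGl r hr.le).1.trans hNM'))
        ((hGl r hr.le).2.trans hNM')
    · rw [eVtt]; exact half' _ _ _ ((hGs r hr.le).1.trans hNM') ((hGs r hr.le).2.trans hNM')
    · intro h
      have := mvt0 (M := M) hr.le (fun x => H.Phi_drt hk x t) (by simp) (fun x h0 h1 =>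
          half' _ _ _ ((abs_neg _).trans_le ((hGl x h0).1.trans (near (Or.inr h) x h0 h1)))
            ((hGl x h0).2.trans (near (Or.inr h) x h0 h1)))
      rw [eVt]; linarith
    · intro h
      have hder : ∀ x, HasDerivAt (fun x => x * ((Iop G x t + Iop G (-x) t) / 2) - Phi G x t)
          (x * ((-Iop Gl x t + Iop Gl (-x) t) / 2)) x := fun x => by
        have := ((hasDerivAt_id x).mul (H.Phi_drr hk x t)).sub (H.Phi_dr hk x t)
        refine this.congr_deriv ?_
        simp
      have := mvt0 (M := r * M) hr.le hder (by simp [P0]) (fun x h0 h1 => by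
        rw [abs_mul, abs_of_nonneg h0]
        refine mul_le_mul h1 ?_ (abs_nonneg _) hr.le
        exact half _ _ _ ((abs_neg _).trans_le ((hGl x h0).1.trans (near (Or.inr h) x h0 h1)))
            ((hGl x h0).2.trans (near (Or.inr h) x h0 h1)))
      rw [eVr, eV]
      refine this.trans (le_of_eq ?_)
      ring
  refine res.trans (le_of_eq ?_)
  rw [hM, C2]; ring

end

end

section

open Real MeasureTheory Filter Set Topology

noncomputable section

lemma freq_zero {g : ℝ → ℝ} {E x : ℝ} {s : Set ℝ} (hg : HasDerivWithinAt g E s x)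
    (hf : ∃ᶠ y in 𝓝[s \ {x}] x, g y = 0) : g x = 0 ∧ E = 0 := by
  have h1 : Tendsto g (𝓝[s \ {x}] x) (𝓝 (g x)) :=
    hg.continuousWithinAt.mono_left (nhdsWithin_mono _ sdiff_subset)
  have h2 : g x = 0 := isClosed_singleton.mem_of_frequently_of_tendsto (s := {(0:ℝ)}) hf h1
  refine ⟨h2, ?_⟩
  have h3 := hasDerivWithinAt_iff_tendsto_slope.1 hg
  refine isClosed_singleton.mem_of_frequently_of_tendsto (s := {(0:ℝ)}) ?_ h3
  refine hf.mono fun y hy => ?_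
  simp [slope_def_field, hy, h2]

/-- Regularity data on `r > 0`, `t ≥ 0`. -/
structure Reg (v a b ar br bt : ℝ → ℝ → ℝ) : Prop where
  dr : ∀ r t, 0 < r → 0 ≤ t → HasDerivAt (fun r => v r t) (a r t) r
  dt : ∀ r t, 0 < r → 0 ≤ t → HasDerivWithinAt (fun t => v r t) (b r t) (Ici 0) t
  drr : ∀ r t, 0 < r → 0 ≤ t → HasDerivAt (fun r => a r t) (ar r t) r
  drt : ∀ r t, 0 < r → 0 ≤ t → HasDerivAt (fun r => b r t) (br r t) r
  dtt : ∀ r t, 0 < r → 0 ≤ t → HasDerivWithinAt (fun t => b r t) (bt r t) (Ici 0) t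
  ca : ∀ r, 0 < r → ContinuousOn (fun t => a r t) (Ici 0)
  car : ∀ r, 0 < r → ContinuousOn (fun t => ar r t) (Ici 0)
  cbr : ∀ r, 0 < r → ContinuousOn (fun t => br r t) (Ici 0)
  cbt : ∀ r, 0 < r → ContinuousOn (fun t => bt r t) (Ici 0)

variable {v a b ar br bt v' a' b' ar' br' bt' : ℝ → ℝ → ℝ}

lemma Reg.sub (R : Reg v a b ar br bt) (R' : Reg v' a' b' ar' br' bt') :
    Reg (v - v') (a - a') (b - b') (ar - ar') (br - br') (bt - bt') where
  dr r t h0 h1 := (R.dr r t h0 h1).sub (R'.dr r t h0 h1)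
  dt r t h0 h1 := (R.dt r t h0 h1).sub (R'.dt r t h0 h1)
  drr r t h0 h1 := (R.drr r t h0 h1).sub (R'.drr r t h0 h1)
  drt r t h0 h1 := (R.drt r t h0 h1).sub (R'.drt r t h0 h1)
  dtt r t h0 h1 := (R.dtt r t h0 h1).sub (R'.dtt r t h0 h1)
  ca r h0 := (R.ca r h0).sub (R'.ca r h0)
  car r h0 := (R.car r h0).sub (R'.car r h0)
  cbr r h0 := (R.cbr r h0).sub (R'.cbr r h0)
  cbt r h0 := (R.cbt r h0).sub (R'.cbt r h0)

lemma Reg.pdr_eq (R : Reg v a b ar br bt) {r t : ℝ} (hr : 0 < r) (ht : 0 ≤ t) :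
    pdr v r t = a r t := (R.dr r t hr ht).deriv

lemma Reg.pdrr_eq (R : Reg v a b ar br bt) {r t : ℝ} (hr : 0 < r) (ht : 0 ≤ t) :
    pdr (pdr v) r t = ar r t := by
  have : (fun r' => pdr v r' t) =ᶠ[𝓝 r] fun r' => a r' t := by
    filter_upwards [Ioi_mem_nhds hr] with x hx using R.pdr_eq hx ht
  rw [pdr, this.deriv_eq]
  exact (R.drr r t hr ht).deriv

lemma Reg.pdt_eq (R : Reg v a b ar br bt) {r t : ℝ} (hr : 0 < r) (ht : 0 < t) :
    pdt v r t = b r t := ((R.dt r t hr ht.le).hasDerivAt (Ici_mem_nhds ht)).deriv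

lemma Reg.pdrt_eq (R : Reg v a b ar br bt) {r t : ℝ} (hr : 0 < r) (ht : 0 < t) :
    pdr (pdt v) r t = br r t := by
  have : (fun r' => pdt v r' t) =ᶠ[𝓝 r] fun r' => b r' t := by
    filter_upwards [Ioi_mem_nhds hr] with x hx using R.pdt_eq hx ht
  rw [pdr, this.deriv_eq]
  exact (R.drt r t hr ht.le).deriv

lemma Reg.pdtt_eq (R : Reg v a b ar br bt) {r t : ℝ} (hr : 0 < r) (ht : 0 < t) :
    pdt (pdt v) r t = bt r t := by
  have : (fun t' => pdt v r t') =ᶠ[𝓝 t] fun t' => b r t' := by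
    filter_upwards [Ioi_mem_nhds ht] with x hx using R.pdt_eq hr hx
  rw [pdt, this.deriv_eq]
  exact ((R.dtt r t hr ht.le).hasDerivAt (Ici_mem_nhds ht)).deriv

lemma Reg.pdt_zero (R : Reg v a b ar br bt) {r : ℝ} (hr : 0 < r) :
    pdt v r 0 = b r 0 ∨ pdt v r 0 = 0 := by
  by_cases h : DifferentiableAt ℝ (fun t => v r t) 0
  · left
    have h1 := h.hasDerivAt.hasDerivWithinAt (s := Ici 0)
    exact (uniqueDiffOn_Ici (0:ℝ) 0 self_mem_Ici).eq_deriv _ h1 (R.dt r 0 hr le_rfl)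
  · right; exact deriv_zero_of_not_differentiableAt h

lemma Reg.pdrt_zero (R : Reg v a b ar br bt) {r : ℝ} (hr : 0 < r) :
    |pdr (pdt v) r 0| ≤ |br r 0| := by
  by_cases h : DifferentiableAt ℝ (fun r => pdt v r 0) r
  · have h1 : HasDerivAt (fun r => pdt v r 0) (pdr (pdt v) r 0) r := h.hasDerivAt
    by_cases hf : ∃ᶠ y in 𝓝[univ \ {r}] r, pdt v y 0 - b y 0 = 0
    · have := freq_zero (h1.sub (R.drt r 0 hr le_rfl)).hasDerivWithinAt hf
      rw [sub_eq_zero.1 this.2]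
    · have hev : ∀ᶠ y in 𝓝[univ \ {r}] r, pdt v y 0 = 0 := by
        have h2 := not_frequently.1 hf
        have h3 : ∀ᶠ y in 𝓝[univ \ {r}] r, 0 < y :=
          nhdsWithin_le_nhds (Ioi_mem_nhds hr)
        filter_upwards [h2, h3] with y hy hy0
        rcases R.pdt_zero hy0 with h | h
        · exact absurd (sub_eq_zero.2 h) hy
        · exact h
      have hne : (𝓝[univ \ {r}] r).NeBot := by
        rw [← compl_eq_univ_sdiff]; infer_instance
      have := freq_zero h1.hasDerivWithinAt hev.frequently
      rw [this.2]; simp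
  · rw [show pdr (pdt v) r 0 = 0 from deriv_zero_of_not_differentiableAt h]; simp

lemma Reg.pdtt_zero (R : Reg v a b ar br bt) {r : ℝ} (hr : 0 < r) :
    |pdt (pdt v) r 0| ≤ |bt r 0| := by
  by_cases h : DifferentiableAt ℝ (fun t => pdt v r t) 0
  · have h1 : HasDerivAt (fun t => pdt v r t) (pdt (pdt v) r 0) 0 := h.hasDerivAt
    have hev : ∀ᶠ y in 𝓝[Ici 0 \ {0}] (0:ℝ), pdt v r y - b r y = 0 := by
      filter_upwards [self_mem_nhdsWithin] with y hy
      have : 0 < y := lt_of_le_of_ne hy.1 (Ne.symm hy.2)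
      rw [R.pdt_eq hr this, sub_self]
    have hne : (𝓝[Ici 0 \ {0}] (0:ℝ)).NeBot := by
      rw [Ici_sdiff_left]; infer_instance
    have := freq_zero (h1.hasDerivWithinAt.sub (R.dtt r 0 hr le_rfl)) hev.frequently
    rw [sub_eq_zero.1 this.2]
  · rw [show pdt (pdt v) r 0 = 0 from deriv_zero_of_not_differentiableAt h]; simp

/-- The majorant along regularity data. -/
def majF (v a b ar br bt : ℝ → ℝ → ℝ) (r t : ℝ) : ℝ :=
  maj r (v r t) (a r t) (b r t) (ar r t) (br r t) (bt r t)

lemma Reg.bracket_eq (R : Reg v a b ar br bt) {r t : ℝ} (hr : 0 < r) (ht : 0 < t) :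
    bracket2 v r t = majF v a b ar br bt r t := by
  unfold bracket2 majF maj
  rw [R.pdr_eq hr ht.le, R.pdt_eq hr ht, R.pdrr_eq hr ht.le, R.pdrt_eq hr ht, R.pdtt_eq hr ht]

lemma Reg.bracket_le (R : Reg v a b ar br bt) {r t : ℝ} (hr : 0 < r) (ht : 0 ≤ t) :
    bracket2 v r t ≤ majF v a b ar br bt r t := by
  rcases ht.eq_or_lt with rfl | ht
  · unfold bracket2 majF maj
    rw [R.pdr_eq hr le_rfl, R.pdrr_eq hr le_rfl]
    have h1 : |pdt v r 0| ≤ |b r 0| := by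
      rcases R.pdt_zero hr with h | h <;> rw [h]
      simp
    have h2 := R.pdrt_zero hr
    have h3 := R.pdtt_zero hr
    gcongr
  · exact (R.bracket_eq hr ht).le

lemma bracket2_nonneg (v : ℝ → ℝ → ℝ) {r : ℝ} (t : ℝ) (hr : 0 < r) : 0 ≤ bracket2 v r t := by
  unfold bracket2; positivity

lemma wB_mul {k r t : ℝ} (hr : 0 ≤ r) (ht : 0 ≤ t) :
    wB k r t * ((1 + r + t) ^ (k - 1) * (1 + |r - t|)) = 1 := by
  unfold wB
  rw [Real.rpow_neg (by positivity)]
  have : (1 + r + t) ^ (k - 1) ≠ 0 := by positivity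
  have : 1 + |r - t| ≠ 0 := by positivity
  field_simp

lemma ZSet_nonneg {k : ℝ} {v : ℝ → ℝ → ℝ} : ∀ x ∈ ZSet 2 k v, 0 ≤ x := by
  rintro x ⟨r, t, hr, ht, rfl⟩
  have := bracket2_nonneg v t hr
  have e : bracketS 2 v r t = bracket2 v r t := by simp [bracketS]
  rw [e]; positivity

lemma Znorm_nonneg (k : ℝ) (v : ℝ → ℝ → ℝ) : 0 ≤ Znorm 2 k v := Real.sSup_nonneg ZSet_nonneg

lemma ZSet_of_bound {k M : ℝ} {v : ℝ → ℝ → ℝ}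
    (h : ∀ r t, 0 < r → 0 ≤ t → bracket2 v r t ≤ M * wB k r t) :
    BddAbove (ZSet 2 k v) ∧ Znorm 2 k v ≤ M := by
  have hb : ∀ x ∈ ZSet 2 k v, x ≤ M := by
    rintro x ⟨r, t, hr, ht, rfl⟩
    have e : bracketS 2 v r t = bracket2 v r t := by simp [bracketS]
    rw [e, mul_assoc]
    have h1 := mul_le_mul_of_nonneg_right (h r t hr ht)
      (show 0 ≤ (1 + r + t) ^ (k - 1) * (1 + |r - t|) by positivity)
    rw [mul_assoc M, wB_mul hr.le ht, mul_one] at h1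
    exact h1
  exact ⟨⟨M, hb⟩, csSup_le ⟨_, 1, 1, one_pos, zero_le_one, rfl⟩ hb⟩

lemma bracket_le_Znorm {k : ℝ} {v : ℝ → ℝ → ℝ} (h : BddAbove (ZSet 2 k v)) {r t : ℝ}
    (hr : 0 < r) (ht : 0 ≤ t) : bracket2 v r t ≤ Znorm 2 k v * wB k r t := by
  have h1 : bracket2 v r t * (1 + r + t) ^ (k - 1) * (1 + |r - t|) ≤ Znorm 2 k v :=
    le_csSup h ⟨r, t, hr, ht, by simp [bracketS]⟩
  have h2 := mul_le_mul_of_nonneg_right h1 (wB_nonneg (k := k) hr.le ht)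
  have e : bracket2 v r t * (1 + r + t) ^ (k - 1) * (1 + |r - t|) * wB k r t = bracket2 v r t := by
    calc _ = bracket2 v r t * (wB k r t * ((1 + r + t) ^ (k - 1) * (1 + |r - t|))) := by ring
      _ = _ := by rw [wB_mul hr.le ht, mul_one]
  rwa [e] at h2

lemma Reg.majF_cont (R : Reg v a b ar br bt) {r : ℝ} (hr : 0 < r) :
    ContinuousOn (fun t => majF v a b ar br bt r t) (Ici 0) := by
  have cv : ContinuousOn (fun t => v r t) (Ici 0) := fun t ht => (R.dt r t hr ht).continuousWithinAt
  have cb : ContinuousOn (fun t => b r t) (Ici 0) := fun t ht => (R.dtt r t hr ht).continuousWithinAt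
  have := R.ca r hr
  have := R.car r hr
  have := R.cbr r hr
  have := R.cbt r hr
  unfold majF maj
  fun_prop

lemma wB_cont {k r : ℝ} (hr : 0 ≤ r) : ContinuousOn (fun t => wB k r t) (Ici 0) := by
  unfold wB
  refine ContinuousOn.mul ?_ ?_
  · refine ContinuousOn.rpow_const (by fun_prop) fun t ht => Or.inl ?_
    have : (0:ℝ) ≤ t := ht
    positivity
  · refine ContinuousOn.inv₀ (by fun_prop) fun t ht => ?_
    positivity

lemma Reg.maj_le (R : Reg v a b ar br bt) {k M : ℝ} (h : BddAbove (ZSet 2 k v))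
    (hM : Znorm 2 k v ≤ M) {r t : ℝ} (hr : 0 < r) (ht : 0 ≤ t) :
    majF v a b ar br bt r t ≤ M * wB k r t := by
  have hpos : ∀ t, 0 < t → majF v a b ar br bt r t ≤ M * wB k r t := fun t ht => by
    rw [← R.bracket_eq hr ht]
    exact (bracket_le_Znorm h hr ht.le).trans
      (mul_le_mul_of_nonneg_right hM (wB_nonneg hr.le ht.le))
  rcases ht.eq_or_lt with rfl | ht
  · have h1 : Tendsto (fun t => majF v a b ar br bt r t) (𝓝[>] 0) (𝓝 (majF v a b ar br bt r 0)) :=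
      (R.majF_cont hr 0 self_mem_Ici).mono_left (nhdsWithin_mono _ Ioi_subset_Ici_self)
    have h2 : Tendsto (fun t => M * wB k r t) (𝓝[>] 0) (𝓝 (M * wB k r 0)) :=
      ((wB_cont hr.le 0 self_mem_Ici).mono_left
        (nhdsWithin_mono _ Ioi_subset_Ici_self)).const_mul M
    exact le_of_tendsto_of_tendsto h1 h2 (by
      filter_upwards [self_mem_nhdsWithin] with t ht using hpos t ht)
  · exact hpos t ht

lemma Reg.congr (R : Reg v a b ar br bt) (h : ∀ r t, 0 < r → 0 ≤ t → v' r t = v r t) :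
    Reg v' a b ar br bt where
  dr r t h0 h1 := (R.dr r t h0 h1).congr_of_eventuallyEq (by
    filter_upwards [Ioi_mem_nhds h0] with x hx using h x t hx h1)
  dt r t h0 h1 := (R.dt r t h0 h1).congr (fun x hx => h r x h0 hx) (h r t h0 h1)
  drr := R.drr
  drt := R.drt
  dtt := R.dtt
  ca := R.ca
  car := R.car
  cbr := R.cbr
  cbt := R.cbt

/-- Data for the function `V = r v`. -/
structure VReg (V Vr Vt Vrr Vrt Vtt : ℝ → ℝ → ℝ) : Prop where
  dr : ∀ r t, 0 ≤ t → HasDerivAt (fun r => V r t) (Vr r t) r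
  dt : ∀ r t, 0 ≤ t → HasDerivWithinAt (fun t => V r t) (Vt r t) (Ici 0) t
  drr : ∀ r t, 0 ≤ t → HasDerivAt (fun r => Vr r t) (Vrr r t) r
  drt : ∀ r t, 0 ≤ t → HasDerivAt (fun r => Vt r t) (Vrt r t) r
  dtt : ∀ r t, 0 ≤ t → HasDerivWithinAt (fun t => Vt r t) (Vtt r t) (Ici 0) t
  cr : ∀ r, ContinuousOn (fun t => Vr r t) (Ici 0)
  crr : ∀ r, ContinuousOn (fun t => Vrr r t) (Ici 0)
  crt : ∀ r, ContinuousOn (fun t => Vrt r t) (Ici 0)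
  ctt : ∀ r, ContinuousOn (fun t => Vtt r t) (Ici 0)

variable {V Vr Vt Vrr Vrt Vtt : ℝ → ℝ → ℝ}

lemma VReg.reg (R : VReg V Vr Vt Vrr Vrt Vtt) (h : ∀ r t, 0 < r → 0 ≤ t → v r t = V r t / r) :
    Reg v (fun r t => Vr r t / r - V r t / r ^ 2) (fun r t => Vt r t / r)
      (fun r t => Vrr r t / r - 2 * Vr r t / r ^ 2 + 2 * V r t / r ^ 3)
      (fun r t => Vrt r t / r - Vt r t / r ^ 2) (fun r t => Vtt r t / r) := by
  have cV : ∀ r, ContinuousOn (fun t => V r t) (Ici 0) :=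
    fun r t ht => (R.dt r t ht).continuousWithinAt
  have cVt : ∀ r, ContinuousOn (fun t => Vt r t) (Ici 0) :=
    fun r t ht => (R.dtt r t ht).continuousWithinAt
  have key : Reg (fun r t => V r t / r) (fun r t => Vr r t / r - V r t / r ^ 2)
      (fun r t => Vt r t / r)
      (fun r t => Vrr r t / r - 2 * Vr r t / r ^ 2 + 2 * V r t / r ^ 3)
      (fun r t => Vrt r t / r - Vt r t / r ^ 2) (fun r t => Vtt r t / r) :=
    { dr := fun r t hr ht => ((R.dr r t ht).div (hasDerivAt_id r) hr.ne').congr_deriv (by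
        simp only [id]; field_simp)
      dt := fun r t hr ht => (R.dt r t ht).div_const r
      drr := fun r t hr ht => (((R.drr r t ht).div (hasDerivAt_id r) hr.ne').sub
        ((R.dr r t ht).div (hasDerivAt_pow 2 r) (by positivity))).congr_deriv (by
          simp only [id]; field_simp; push_cast; ring)
      drt := fun r t hr ht => ((R.drt r t ht).div (hasDerivAt_id r) hr.ne').congr_deriv (by
        simp only [id]; field_simp)
      dtt := fun r t hr ht => (R.dtt r t ht).div_const r
      ca := fun r hr => ((R.cr r).div_const _).sub ((cV r).div_const _)
      car := fun r hr => (((R.crr r).div_const _).sub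
        ((continuousOn_const.mul (R.cr r)).div_const _)).add
        ((continuousOn_const.mul (cV r)).div_const _)
      cbr := fun r hr => ((R.crt r).div_const _).sub ((cVt r).div_const _)
      cbt := fun r hr => (R.ctt r).div_const _ }
  exact key.congr h

variable {k d A : ℝ} {G Gl Gs : ℝ → ℝ → ℝ}

/-- The linear estimate for functions of the form `Phi G r t / r`. -/
lemma SrcC1.final (H : SrcC1 k d A G Gl Gs) (hk : 1 < k) (hd : k + 1 < d) {w : ℝ → ℝ → ℝ}
    (hw : ∀ r t, 0 < r → 0 ≤ t → w r t = Phi G r t / r) :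
    BddAbove (ZSet 2 k w) ∧ Znorm 2 k w ≤ C2 k d * A := by
  have hc : ∀ {F}, Src k d A F → ∀ r, ContinuousOn (fun t => Iop F r t) (Ici 0) :=
    fun hF r => (SrcC1.aux_cont hF hk continuous_const continuous_id).continuousOn
  have VR : VReg (Phi G) (fun r t => (Iop G r t + Iop G (-r) t) / 2)
      (fun r t => (Iop G r t - Iop G (-r) t) / 2)
      (fun r t => (-Iop Gl r t + Iop Gl (-r) t) / 2)
      (fun r t => (-Iop Gl r t - Iop Gl (-r) t) / 2)
      (fun r t => (Iop Gs r t - Iop Gs (-r) t) / 2) :=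
    { dr := fun r t _ => H.Phi_dr hk r t
      dt := fun r t ht => H.Phi_dt hk hd r ht
      drr := fun r t _ => H.Phi_drr hk r t
      drt := fun r t _ => H.Phi_drt hk r t
      dtt := fun r t ht => H.Phi_dtt hk r ht
      cr := fun r => ((hc H.h r).add (hc H.h (-r))).div_const _
      crr := fun r => ((hc H.hl r).neg.add (hc H.hl (-r))).div_const _
      crt := fun r => ((hc H.hl r).neg.sub (hc H.hl (-r))).div_const _
      ctt := fun r => ((hc H.hs r).sub (hc H.hs (-r))).div_const _ }
  have R := VR.reg hw
  refine ZSet_of_bound fun r t hr ht => (R.bracket_le hr ht).trans ?_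
  unfold majF
  simp only [hw r t hr ht]
  exact H.maj_bd hk hd hr ht rfl rfl rfl rfl rfl rfl

end

end

section

open Real MeasureTheory Filter Set Topology

noncomputable section

lemma extract (n : ℕ) {G : ℝ × ℝ → ℝ}
    (h : ContDiffOn ℝ ((n + 1 : ℕ) : WithTop ℕ∞) G (univ ×ˢ Ici (0:ℝ))) :
    ∃ Gr Gt : ℝ → ℝ → ℝ,
      ContDiffOn ℝ (n : WithTop ℕ∞) (Function.uncurry Gr) (univ ×ˢ Ici (0:ℝ)) ∧
      ContDiffOn ℝ (n : WithTop ℕ∞) (Function.uncurry Gt) (univ ×ˢ Ici (0:ℝ)) ∧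
      (∀ r t, 0 ≤ t → HasDerivAt (fun r => G (r, t)) (Gr r t) r) ∧
      (∀ r t, 0 ≤ t → HasDerivWithinAt (fun t => G (r, t)) (Gt r t) (Ici 0) t) := by
  have hS : UniqueDiffOn ℝ (univ ×ˢ Ici (0:ℝ) : Set (ℝ × ℝ)) :=
    uniqueDiffOn_univ.prod (uniqueDiffOn_Ici 0)
  have hD : ContDiffOn ℝ (n : WithTop ℕ∞) (fderivWithin ℝ G (univ ×ˢ Ici (0:ℝ)))
      (univ ×ˢ Ici (0:ℝ)) := h.fderivWithin hS (by push_cast; rfl)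
  have hdiff : ∀ r t, 0 ≤ t → HasFDerivWithinAt G (fderivWithin ℝ G (univ ×ˢ Ici (0:ℝ)) (r, t))
      (univ ×ˢ Ici (0:ℝ)) (r, t) := fun r t ht =>
    ((h.differentiableOn (by simp)) (r, t) ⟨mem_univ _, ht⟩).hasFDerivWithinAt
  refine ⟨fun r t => fderivWithin ℝ G (univ ×ˢ Ici (0:ℝ)) (r, t) (1, 0),
    fun r t => fderivWithin ℝ G (univ ×ˢ Ici (0:ℝ)) (r, t) (0, 1),
    hD.clm_apply contDiffOn_const, hD.clm_apply contDiffOn_const, ?_, ?_⟩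
  · intro r t ht
    have h1 : HasDerivWithinAt (fun r : ℝ => (r, t)) ((1:ℝ), (0:ℝ)) univ r :=
      ((hasDerivAt_id r).prodMk (hasDerivAt_const r t)).hasDerivWithinAt
    have h2 : MapsTo (fun r : ℝ => (r, t)) univ (univ ×ˢ Ici (0:ℝ)) :=
      fun x _ => ⟨mem_univ _, ht⟩
    have := (hdiff r t ht).comp_hasDerivWithinAt r h1 h2
    exact hasDerivWithinAt_univ.1 this
  · intro r t ht
    have h1 : HasDerivWithinAt (fun t : ℝ => (r, t)) ((0:ℝ), (1:ℝ)) (Ici 0) t :=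
      ((hasDerivAt_const t r).prodMk (hasDerivAt_id t)).hasDerivWithinAt
    exact (hdiff r t ht).comp_hasDerivWithinAt t h1 (fun x hx => ⟨mem_univ _, hx⟩)

lemma slice_cont {F : ℝ → ℝ → ℝ} (h : ContinuousOn (Function.uncurry F) (univ ×ˢ Ici (0:ℝ)))
    (r : ℝ) : ContinuousOn (fun t => F r t) (Ici 0) :=
  h.comp (f := fun t : ℝ => (r, t)) (by fun_prop) fun t ht => ⟨mem_univ _, ht⟩

/-- Data attached to a function of class `X²`: `n = ∂_t u`, `m = r n`, and derivatives of `m`. -/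
structure UD (u n m ml ms : ℝ → ℝ → ℝ) : Prop where
  nc : ContinuousOn (Function.uncurry n) (univ ×ˢ Ici (0:ℝ))
  mc : ContinuousOn (Function.uncurry m) (univ ×ˢ Ici (0:ℝ))
  mlc : ContinuousOn (Function.uncurry ml) (univ ×ˢ Ici (0:ℝ))
  msc : ContinuousOn (Function.uncurry ms) (univ ×ˢ Ici (0:ℝ))
  dt : ∀ l s, 0 ≤ s → HasDerivWithinAt (fun s => u l s) (n l s) (Ici 0) s
  mn : ∀ l s, 0 ≤ s → m l s = l * n l s
  dml : ∀ l s, 0 ≤ s → HasDerivAt (fun l => m l s) (ml l s) l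
  dms : ∀ l s, 0 ≤ s → HasDerivWithinAt (fun s => m l s) (ms l s) (Ici 0) s
  even : ∀ l s, 0 ≤ s → n (-l) s = n l s
  reg : ∃ a ar, Reg u a (fun r t => m r t / r) ar (fun r t => ml r t / r - m r t / r ^ 2)
    (fun r t => ms r t / r)

lemma exists_UD {u : ℝ → ℝ → ℝ} (h : memX 2 u) : ∃ n m ml ms, UD u n m ml ms := by
  obtain ⟨h1, h2, h3⟩ := h
  have h1' : ContDiffOn ℝ ((0 + 1 : ℕ) : WithTop ℕ∞) (fun z : ℝ × ℝ => u z.1 z.2)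
      (univ ×ˢ Ici (0:ℝ)) := h1
  have h2' : ContDiffOn ℝ ((1 + 1 : ℕ) : WithTop ℕ∞) (fun z : ℝ × ℝ => z.1 * u z.1 z.2)
      (univ ×ˢ Ici (0:ℝ)) := h2
  obtain ⟨a0, n, -, nc, -, dn⟩ := extract 0 h1'
  obtain ⟨Vr, m, cVr, cm, dVr, dm⟩ := extract 1 h2'
  obtain ⟨Vrr, _, cVrr, -, dVrr, -⟩ := extract 0 (G := Function.uncurry Vr) cVr
  obtain ⟨ml, ms, cml, cms, dml, dms⟩ := extract 0 (G := Function.uncurry m) cm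
  have uq : ∀ t : ℝ, 0 ≤ t → UniqueDiffWithinAt ℝ (Ici (0:ℝ)) t :=
    fun t ht => uniqueDiffOn_Ici (0:ℝ) t ht
  refine ⟨n, m, ml, ms, nc.continuousOn, cm.continuousOn, cml.continuousOn, cms.continuousOn,
    dn, ?_, dml, dms, ?_, ?_⟩
  · intro l s hs
    exact (uq s hs).eq_deriv _ (dm l s hs) ((dn l s hs).const_mul l)
  · intro l s hs
    refine (uq s hs).eq_deriv _ (dn (-l) s hs) ?_
    exact (dn l s hs).congr (fun x hx => h3 l x hx) (h3 l s hs)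
  · have VR : VReg (fun r t => r * u r t) Vr m Vrr ml ms :=
      { dr := dVr
        dt := dm
        drr := dVrr
        drt := dml
        dtt := dms
        cr := slice_cont cVr.continuousOn
        crr := slice_cont cVrr.continuousOn
        crt := slice_cont cml.continuousOn
        ctt := slice_cont cms.continuousOn }
    exact ⟨_, _, VR.reg (v := u) fun r t hr _ => by field_simp⟩

/-! ### The free solution -/

lemma deriv_even {f : ℝ → ℝ} (h : ∀ x, f (-x) = f x) (x : ℝ) : deriv f (-x) = -deriv f x := by
  have h1 := deriv_comp_neg f x
  rw [show (fun x => f (-x)) = f from funext h] at h1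
  linarith

lemma deriv_odd {f : ℝ → ℝ} (h : ∀ x, f (-x) = -f x) (x : ℝ) : deriv f (-x) = deriv f x := by
  have h1 := deriv_comp_neg f x
  rw [show (fun x => f (-x)) = fun x => -f x from funext h, deriv.fun_neg] at h1
  linarith

lemma even_bound {g : ℝ → ℝ} {ν c : ℝ} (hg : Continuous g) (he : ∀ x, |g (-x)| = |g x|)
    (h : ∀ x, 0 < x → |g x| ≤ c * (1 + x) ^ (-ν)) (x : ℝ) : |g x| ≤ c * (1 + |x|) ^ (-ν) := by
  have h0 : |g 0| ≤ c * (1 + |(0:ℝ)|) ^ (-ν) := by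
    have h1 : Tendsto (fun x => |g x|) (𝓝[>] 0) (𝓝 |g 0|) := hg.abs.continuousAt.continuousWithinAt
    have h2 : Tendsto (fun x : ℝ => c * (1 + |x|) ^ (-ν)) (𝓝[>] 0) (𝓝 (c * (1 + |(0:ℝ)|) ^ (-ν))) := by
      refine Continuous.continuousWithinAt ?_
      refine continuous_const.mul (Continuous.rpow_const (by fun_prop) fun x => Or.inl ?_)
      positivity
    refine le_of_tendsto_of_tendsto h1 h2 ?_
    filter_upwards [self_mem_nhdsWithin] with y hy
    have hy : 0 < y := hy
    rw [abs_of_pos hy]; exact h y hy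
  rcases lt_trichotomy x 0 with hx | rfl | hx
  · rw [← he, abs_of_neg hx]; exact h (-x) (by linarith)
  · exact h0
  · rw [abs_of_pos hx]; exact h x hx

/-- Bounds for the building blocks of the free solution. -/
lemma Y_bounds {ν ε : ℝ} {fg : (ℝ → ℝ) × (ℝ → ℝ)} (h : memY ν ε fg) :
    ∃ ψ χ ψ1 χ1 χ2 : ℝ → ℝ, (∀ x, ψ x = x * fg.2 x) ∧ (∀ x, χ x = x * fg.1 x) ∧
      (∀ x, HasDerivAt ψ (ψ1 x) x) ∧ (∀ x, HasDerivAt χ (χ1 x) x) ∧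
      (∀ x, HasDerivAt χ1 (χ2 x) x) ∧ Continuous ψ1 ∧ Continuous χ2 ∧
      (∀ x, ψ (-x) = -ψ x) ∧ (∀ x, χ1 (-x) = χ1 x) ∧
      (∀ x, |ψ x| ≤ ε * (1 + |x|) ^ (-ν)) ∧ (∀ x, |χ1 x| ≤ ε * (1 + |x|) ^ (-ν)) ∧
      (∀ x, |ψ1 x| ≤ ε * (1 + |x|) ^ (-ν)) ∧ (∀ x, |χ2 x| ≤ 2 * ε * (1 + |x|) ^ (-ν)) := by
  obtain ⟨f, g⟩ := fg
  obtain ⟨hf, hg, ef, eg, hχ, hψ, hb⟩ := h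
  simp only at *
  set ψ : ℝ → ℝ := fun x => x * g x with hψd
  set χ : ℝ → ℝ := fun x => x * f x with hχd
  have dψ : ∀ x, HasDerivAt ψ (deriv ψ x) x := fun x =>
    (hψ.differentiable (by norm_num) x).hasDerivAt
  have dχ : ∀ x, HasDerivAt χ (deriv χ x) x := fun x =>
    (hχ.differentiable (by norm_num) x).hasDerivAt
  have hχ' : ContDiff ℝ 1 (deriv χ) := by
    have : ContDiff ℝ (1 + 1) χ := by norm_num; exact hχ
    exact (contDiff_succ_iff_deriv.1 this).2.2
  have dχ1 : ∀ x, HasDerivAt (deriv χ) (deriv (deriv χ) x) x := fun x =>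
    (hχ'.differentiable (by norm_num) x).hasDerivAt
  have oψ : ∀ x, ψ (-x) = -ψ x := fun x => by simp only [hψd, eg]; ring
  have oχ : ∀ x, χ (-x) = -χ x := fun x => by simp only [hχd, ef]; ring
  have eχ1 := deriv_odd oχ
  have oχ2 := deriv_even eχ1
  have eψ1 := deriv_odd oψ
  have cψ1 : Continuous (deriv ψ) := hψ.continuous_deriv (by norm_num)
  have cχ2 : Continuous (deriv (deriv χ)) := hχ'.continuous_deriv (by norm_num)
  have df : ∀ x, HasDerivAt f (deriv f x) x := fun x =>
    (hf.differentiable (by norm_num) x).hasDerivAt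
  have main : ∀ x, 0 < x → tripleNorm f g x ≤ ε * (1 + x) ^ (-ν) := fun x hx => by
    have h1 := hb x hx
    have h2 : (0:ℝ) < (1 + x) ^ ν := by positivity
    rw [Real.rpow_neg (by positivity), ← div_eq_mul_inv, le_div_iff₀ h2]
    unfold tnorm at h1; linarith
  -- formulas on the positive half line
  have fχ1 : ∀ x, deriv χ x = f x + x * deriv f x := fun x => by
    have := ((hasDerivAt_id x).mul (df x)).deriv
    rw [show χ = id * f from rfl, this]; simp
  have fψ1 : ∀ x, 0 < x → deriv ψ x = g x + x * deriv g x := fun x hx => by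
    have h1 : HasDerivAt (fun y => ψ y / y) ((deriv ψ x * x - ψ x * 1) / x ^ 2) x :=
      (dψ x).div (hasDerivAt_id x) hx.ne'
    have h2 : (fun y => ψ y / y) =ᶠ[𝓝 x] g := by
      filter_upwards [Ioi_mem_nhds hx] with y hy
      have : y ≠ 0 := (show 0 < y from hy).ne'
      simp only [hψd]; field_simp
    have h3 := (h1.congr_of_eventuallyEq h2.symm).deriv
    rw [h3]; simp only [hψd]; field_simp; ring
  have fχ2 : ∀ x, 0 < x → deriv (deriv χ) x = 2 * deriv f x + x * deriv (deriv f) x :=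
    fun x hx => by
      have h1 : HasDerivAt (fun y => (deriv χ y - f y) / y)
          (((deriv (deriv χ) x - deriv f x) * x - (deriv χ x - f x) * 1) / x ^ 2) x :=
        ((dχ1 x).sub (df x)).div (hasDerivAt_id x) hx.ne'
      have h2 : (fun y => (deriv χ y - f y) / y) =ᶠ[𝓝 x] deriv f := by
        filter_upwards [Ioi_mem_nhds hx] with y hy
        have : y ≠ 0 := (show 0 < y from hy).ne'
        rw [fχ1]; field_simp; ring
      have h3 := (h1.congr_of_eventuallyEq h2.symm).deriv
      rw [h3, fχ1]; field_simp; ring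
  refine ⟨ψ, χ, deriv ψ, deriv χ, deriv (deriv χ), fun _ => rfl, fun _ => rfl, dψ, dχ, dχ1, cψ1,
    cχ2, oψ, eχ1, ?_, ?_, ?_, ?_⟩
  · refine even_bound hψ.continuous (fun x => by rw [oψ, abs_neg]) fun x hx => ?_
    refine le_trans ?_ (main x hx)
    unfold tripleNorm
    simp only [hψd]
    rw [abs_mul, abs_of_pos hx]
    have := abs_nonneg (f x)
    have := abs_nonneg (g x)
    have : 0 ≤ (1 + x) * |deriv f x| := by positivity
    have : 0 ≤ x * (|deriv (deriv f) x| + |deriv g x|) := by positivity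
    nlinarith
  · refine even_bound hχ'.continuous (fun x => by rw [eχ1]) fun x hx => ?_
    refine le_trans ?_ (main x hx)
    unfold tripleNorm
    rw [fχ1]
    refine (abs_add_le _ _).trans ?_
    rw [abs_mul, abs_of_pos hx]
    have := abs_nonneg (deriv f x)
    have : 0 ≤ (1 + x) * |g x| := by positivity
    have : 0 ≤ x * (|deriv (deriv f) x| + |deriv g x|) := by positivity
    nlinarith
  · refine even_bound cψ1 (fun x => by rw [eψ1]) fun x hx => ?_
    refine le_trans ?_ (main x hx)
    unfold tripleNorm
    rw [fψ1 x hx]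
    refine (abs_add_le _ _).trans ?_
    rw [abs_mul, abs_of_pos hx]
    have := abs_nonneg (f x)
    have : 0 ≤ (1 + x) * |deriv f x| := by positivity
    have : 0 ≤ x * |g x| := by positivity
    have : 0 ≤ x * |deriv (deriv f) x| := by positivity
    nlinarith
  · refine even_bound cχ2 (fun x => by rw [oχ2, abs_neg]) fun x hx => ?_
    rw [mul_assoc]
    refine le_trans ?_ (mul_le_mul_of_nonneg_left (main x hx) zero_le_two)
    unfold tripleNorm
    rw [fχ2 x hx]
    refine (abs_add_le _ _).trans ?_
    rw [abs_mul, abs_mul, abs_of_pos hx, abs_of_pos (by norm_num : (0:ℝ) < 2)]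
    have := abs_nonneg (f x)
    have : 0 ≤ (1 + x) * |g x| := by positivity
    have : 0 ≤ x * |deriv f x| := by positivity
    have : 0 ≤ x * |deriv (deriv f) x| := by positivity
    have : 0 ≤ x * |deriv g x| := by positivity
    nlinarith

end

end

section

open Real MeasureTheory Filter Set Topology

noncomputable section

/-- The weight `(1+|r-t|)^{-ν}`. -/
def om (ν x : ℝ) : ℝ := (1 + |x|) ^ (-ν)

lemma om_pos (ν x : ℝ) : 0 < om ν x := by unfold om; positivity

lemma om_cont (ν : ℝ) : Continuous (om ν) := by
  unfold om
  refine Continuous.rpow_const (by fun_prop) fun x => Or.inl ?_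
  positivity

lemma om_anti {ν x y : ℝ} (hν : 0 ≤ ν) (h : |x| ≤ |y|) : om ν y ≤ om ν x :=
  Real.rpow_le_rpow_of_nonpos (by positivity) (by linarith) (by linarith)

lemma om_near {ν x y : ℝ} (hν : 0 ≤ ν) (h : |x - y| ≤ 1) : om ν x ≤ 2 ^ ν * om ν y := by
  refine rpow_neg_le_of_le_mul (by positivity) (by norm_num) hν ?_
  have h1 : |y| ≤ |x| + |x - y| := by
    have := abs_sub_abs_le_abs_sub y x
    rw [abs_sub_comm] at this
    linarith
  have := abs_nonneg x
  linarith

lemma wB_le_om {ν r t : ℝ} (hν : 1 ≤ ν) (hr : 0 ≤ r) (ht : 0 ≤ t) : wB ν r t ≤ om ν (r - t) := by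
  unfold wB om
  have h1 : |r - t| ≤ r + t := by rw [abs_le]; constructor <;> linarith
  have h0 : 0 < 1 + |r - t| := by positivity
  have e : (1 + |r - t|) ^ (-ν) = (1 + |r - t|) ^ (-(ν - 1)) * (1 + |r - t|)⁻¹ := by
    rw [← Real.rpow_neg_one, ← Real.rpow_add h0]; congr 1; ring
  rw [e]
  refine mul_le_mul_of_nonneg_right ?_ (by positivity)
  exact Real.rpow_le_rpow_of_nonpos h0 (by linarith) (by linarith)

/-- Constant for the free solution. -/
def CK (ν : ℝ) : ℝ := 9 * 2 ^ ν

lemma K_data {ν ε : ℝ} (hν : 0 ≤ ν) (hε : 0 ≤ ε) {fg : (ℝ → ℝ) × (ℝ → ℝ)} (h : memY ν ε fg) :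
    ∃ m ml ms a ar : ℝ → ℝ → ℝ, Reg (Kop fg) a (fun r t => m r t / r) ar
      (fun r t => ml r t / r - m r t / r ^ 2) (fun r t => ms r t / r) ∧
      ∀ r t, 0 < r → 0 ≤ t → (1 + r) * |m r t / r| ≤ CK ν * ε * om ν (r - t) ∧
        r * |ml r t / r - m r t / r ^ 2| ≤ CK ν * ε * om ν (r - t) ∧
        r * |ms r t / r| ≤ CK ν * ε * om ν (r - t) := by
  obtain ⟨ψ, χ, ψ1, χ1, χ2, eψ, eχ, dψ, dχ, dχ1, cψ1, cχ2, oψ, eχ1, bψ, bχ1, bψ1, bχ2⟩ :=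
    Y_bounds h
  have cψ : Continuous ψ := continuous_iff_continuousAt.2 fun x => (dψ x).continuousAt
  have cχ : Continuous χ := continuous_iff_continuousAt.2 fun x => (dχ x).continuousAt
  have cχ1 : Continuous χ1 := continuous_iff_continuousAt.2 fun x => (dχ1 x).continuousAt
  -- derivative rules along characteristics
  have rp : ∀ {F F1 : ℝ → ℝ}, (∀ x, HasDerivAt F (F1 x) x) → ∀ r t,
      HasDerivAt (fun r => F (r + t)) (F1 (r + t)) r := fun hF r t => (hF _).comp_add_const r t
  have rm : ∀ {F F1 : ℝ → ℝ}, (∀ x, HasDerivAt F (F1 x) x) → ∀ r t,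
      HasDerivAt (fun r => F (r - t)) (F1 (r - t)) r := fun hF r t => (hF _).comp_sub_const r t
  have tp : ∀ {F F1 : ℝ → ℝ}, (∀ x, HasDerivAt F (F1 x) x) → ∀ r t,
      HasDerivAt (fun t => F (r + t)) (F1 (r + t)) t := fun hF r t => (hF _).comp_const_add r t
  have tm : ∀ {F F1 : ℝ → ℝ}, (∀ x, HasDerivAt F (F1 x) x) → ∀ r t,
      HasDerivAt (fun t => F (r - t)) (-F1 (r - t)) t := fun hF r t => (hF _).comp_const_sub r t
  have prim : ∀ {F : ℝ → ℝ}, Continuous F → ∀ x, HasDerivAt (fun x => ∫ y in (0:ℝ)..x, F y) (F x) x :=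
    fun hF x => intervalIntegral.integral_hasDerivAt_right (hF.intervalIntegrable _ _)
      (hF.stronglyMeasurableAtFilter _ _) hF.continuousAt
  have split : ∀ {F : ℝ → ℝ}, Continuous F → ∀ x y : ℝ, ∫ z in x..y, F z =
      (∫ z in (0:ℝ)..y, F z) - ∫ z in (0:ℝ)..x, F z := fun hF x y =>
    (intervalIntegral.integral_interval_sub_left (hF.intervalIntegrable _ _)
      (hF.intervalIntegrable _ _)).symm
  set Ψ : ℝ → ℝ := fun x => ∫ y in (0:ℝ)..x, ψ y with hΨ
  have dΨ : ∀ x, HasDerivAt Ψ (ψ x) x := prim cψ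
  have eK : ∀ r t, 0 < r → 0 ≤ t → Kop fg r t =
      ((Ψ (r + t) - Ψ (r - t) + (χ (r + t) + χ (r - t))) / 2) / r := by
    intro r t hr _
    have e1 : (∫ l in (r - t)..(r + t), l * fg.2 l) = Ψ (r + t) - Ψ (r - t) := by
      rw [← split cψ]; simp only [eψ]
    have e2 : deriv (fun s : ℝ => ∫ l in (r - s)..(r + s), l * fg.1 l) t = χ (r + t) + χ (r - t) := by
      have : (fun s : ℝ => ∫ l in (r - s)..(r + s), l * fg.1 l) = fun s =>
          (∫ y in (0:ℝ)..(r + s), χ y) - ∫ y in (0:ℝ)..(r - s), χ y := by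
        funext s; rw [← split cχ]; simp only [eχ]
      rw [this]
      have h1 := (tp (prim cχ) r t).sub (tm (prim cχ) r t)
      rw [sub_neg_eq_add] at h1
      exact h1.deriv
    rw [Kop, e1, e2]; field_simp
  have VR : VReg (fun r t => (Ψ (r + t) - Ψ (r - t) + (χ (r + t) + χ (r - t))) / 2)
      (fun r t => (ψ (r + t) - ψ (r - t) + (χ1 (r + t) + χ1 (r - t))) / 2)
      (fun r t => (ψ (r + t) - -ψ (r - t) + (χ1 (r + t) + -χ1 (r - t))) / 2)
      (fun r t => (ψ1 (r + t) - ψ1 (r - t) + (χ2 (r + t) + χ2 (r - t))) / 2)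
      (fun r t => (ψ1 (r + t) - -ψ1 (r - t) + (χ2 (r + t) + -χ2 (r - t))) / 2)
      (fun r t => (ψ1 (r + t) - - -ψ1 (r - t) + (χ2 (r + t) + - -χ2 (r - t))) / 2) :=
    { dr := fun r t _ => (((rp dΨ r t).sub (rm dΨ r t)).add
        ((rp dχ r t).add (rm dχ r t))).div_const 2
      dt := fun r t _ => ((((tp dΨ r t).sub (tm dΨ r t)).add
        ((tp dχ r t).add (tm dχ r t))).div_const 2).hasDerivWithinAt
      drr := fun r t _ => (((rp dψ r t).sub (rm dψ r t)).add
        ((rp dχ1 r t).add (rm dχ1 r t))).div_const 2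
      drt := fun r t _ => (((rp dψ r t).sub (rm dψ r t).neg).add
        ((rp dχ1 r t).add (rm dχ1 r t).neg)).div_const 2
      dtt := fun r t _ => ((((tp dψ r t).sub (tm dψ r t).neg).add
        ((tp dχ1 r t).add (tm dχ1 r t).neg)).div_const 2).hasDerivWithinAt
      cr := fun r => Continuous.continuousOn (by fun_prop)
      crr := fun r => Continuous.continuousOn (by fun_prop)
      crt := fun r => Continuous.continuousOn (by fun_prop)
      ctt := fun r => Continuous.continuousOn (by fun_prop) }
  refine ⟨_, _, _, _, _, VR.reg eK, ?_⟩
  have opm : ∀ r t : ℝ, 0 ≤ r → 0 ≤ t → om ν (r + t) ≤ om ν (r - t) := fun r t hr ht =>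
    om_anti hν (by rw [abs_of_nonneg (show 0 ≤ r + t by linarith), abs_le]; constructor <;> linarith)
  have c4 : ∀ r t {F : ℝ → ℝ} {c : ℝ}, 0 ≤ r → 0 ≤ t → 0 ≤ c → (∀ x, |F x| ≤ c * (1 + |x|) ^ (-ν)) →
      |F (r + t)| ≤ c * om ν (r - t) ∧ |F (r - t)| ≤ c * om ν (r - t) :=
    fun r t F c hr ht hc hF => ⟨(hF _).trans (mul_le_mul_of_nonneg_left (opm r t hr ht) hc), hF _⟩
  have bm : ∀ r t, 0 ≤ r → 0 ≤ t →
      |(ψ (r + t) - -ψ (r - t) + (χ1 (r + t) + -χ1 (r - t))) / 2| ≤ 2 * ε * om ν (r - t) := by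
    intro r t hr ht
    obtain ⟨a1, a2⟩ := c4 r t hr ht hε bψ
    obtain ⟨a3, a4⟩ := c4 r t hr ht hε bχ1
    rw [abs_le] at *
    constructor <;> linarith
  have bml : ∀ r t, 0 ≤ r → 0 ≤ t →
      |(ψ1 (r + t) - -ψ1 (r - t) + (χ2 (r + t) + -χ2 (r - t))) / 2| ≤ 3 * ε * om ν (r - t) := by
    intro r t hr ht
    obtain ⟨a1, a2⟩ := c4 r t hr ht hε bψ1
    obtain ⟨a3, a4⟩ := c4 r t hr ht (by positivity) bχ2
    rw [abs_le] at *
    constructor <;> linarith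
  have bms : ∀ r t, 0 ≤ r → 0 ≤ t →
      |(ψ1 (r + t) - - -ψ1 (r - t) + (χ2 (r + t) + - -χ2 (r - t))) / 2| ≤
        3 * ε * om ν (r - t) := by
    intro r t hr ht
    obtain ⟨a1, a2⟩ := c4 r t hr ht hε bψ1
    obtain ⟨a3, a4⟩ := c4 r t hr ht (by positivity) bχ2
    rw [abs_le] at *
    constructor <;> linarith
  intro r t hr ht
  have two : (1:ℝ) ≤ 2 ^ ν := Real.one_le_rpow (by norm_num) hν
  have hω := om_pos ν (r - t)
  set E := ε * om ν (r - t) with hE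
  have hE0 : 0 ≤ E := by positivity
  have hE2 : E ≤ 2 ^ ν * E := by nlinarith
  set m := (ψ (r + t) - -ψ (r - t) + (χ1 (r + t) + -χ1 (r - t))) / 2 with hm
  have b1 : (1 + r) * |m / r| ≤ 6 * (2 ^ ν * E) := by
    rw [abs_div, abs_of_pos hr, mul_div_assoc', div_le_iff₀ hr]
    rcases le_total r 1 with h1 | h1
    · have := mvt0 (f := fun r => (ψ (r + t) - -ψ (r - t) + (χ1 (r + t) + -χ1 (r - t))) / 2)
        (M := 3 * (2 ^ ν * E)) hr.le (fun x => VR.drt x t ht)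
        (by
          have e1 := oψ t
          have e2 := eχ1 t
          simp only [zero_add, zero_sub, e1, e2]; ring)
        (fun x h0 hx => by
          refine (bml x t h0 ht).trans ?_
          have := om_near (ν := ν) (x := x - t) (y := r - t) hν
            (by rw [abs_le]; constructor <;> linarith)
          rw [hE]
          nlinarith)
      have this : |m| ≤ 3 * (2 ^ ν * E) * r := this
      have := mul_le_mul_of_nonneg_left this (show 0 ≤ 1 + r by linarith)
      have h3 : 0 ≤ 3 * (2 ^ ν * E) * r := by positivity
      nlinarith
    · have := bm r t hr.le ht
      rw [mul_assoc] at this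
      have := abs_nonneg m
      nlinarith
  have b1' : |m / r| ≤ 6 * (2 ^ ν * E) := by nlinarith [abs_nonneg (m / r)]
  have hCK : CK ν * ε * om ν (r - t) = 9 * (2 ^ ν * E) := by rw [CK, hE]; ring
  rw [hCK]
  refine ⟨by linarith, ?_, ?_⟩
  · have e : ∀ x : ℝ, r * |x / r - m / r ^ 2| = |x - m / r| := fun x => by
      nth_rewrite 1 [← abs_of_pos hr]
      rw [← abs_mul]; congr 1; field_simp
    rw [e]
    refine (abs_sub _ _).trans ?_
    have := bml r t hr.le ht
    linarith
  · rw [abs_div, abs_of_pos hr, mul_div_cancel₀ _ hr.ne']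
    have := bms r t hr.le ht
    linarith

end

end

section

open Real MeasureTheory Filter Set Topology

noncomputable section

variable {u n m ml ms u' n' m' ml' ms' : ℝ → ℝ → ℝ}

lemma UD.sub (U : UD u n m ml ms) (U' : UD u' n' m' ml' ms') :
    UD (u - u') (n - n') (m - m') (ml - ml') (ms - ms') where
  nc := U.nc.sub U'.nc
  mc := U.mc.sub U'.mc
  mlc := U.mlc.sub U'.mlc
  msc := U.msc.sub U'.msc
  dt l s hs := (U.dt l s hs).sub (U'.dt l s hs)
  mn l s hs := by simp only [Pi.sub_apply, U.mn l s hs, U'.mn l s hs]; ring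
  dml l s hs := (U.dml l s hs).sub (U'.dml l s hs)
  dms l s hs := (U.dms l s hs).sub (U'.dms l s hs)
  even l s hs := by simp only [Pi.sub_apply, U.even l s hs, U'.even l s hs]
  reg := by
    obtain ⟨a, ar, R⟩ := U.reg
    obtain ⟨a', ar', R'⟩ := U'.reg
    refine ⟨a - a', ar - ar', ?_⟩
    have e1 : (fun r t => (m - m') r t / r) = (fun r t => m r t / r) - fun r t => m' r t / r := by
      funext r t; simp only [Pi.sub_apply]; ring
    have e2 : (fun r t => (ml - ml') r t / r - (m - m') r t / r ^ 2) =
        (fun r t => ml r t / r - m r t / r ^ 2) - fun r t => ml' r t / r - m' r t / r ^ 2 := by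
      funext r t; simp only [Pi.sub_apply]; ring
    have e3 : (fun r t => (ms - ms') r t / r) =
        (fun r t => ms r t / r) - fun r t => ms' r t / r := by
      funext r t; simp only [Pi.sub_apply]; ring
    rw [e1, e2, e3]
    exact R.sub R'

/-- Weighted bounds on `n = ∂_t u` and its derivatives. -/
structure UB (ν B : ℝ) (n ml ms : ℝ → ℝ → ℝ) : Prop where
  b1 : ∀ l s, 0 ≤ s → (1 + |l|) * |n l s| ≤ B * om ν (|l| - s)
  b2 : ∀ l s, 0 ≤ s → |ml l s - n l s| ≤ B * om ν (|l| - s)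
  b3 : ∀ l s, 0 ≤ s → |ms l s| ≤ B * om ν (|l| - s)

lemma slice_cont' {F : ℝ → ℝ → ℝ} (h : ContinuousOn (Function.uncurry F) (univ ×ˢ Ici (0:ℝ)))
    {s : ℝ} (hs : 0 ≤ s) : Continuous (fun l => F l s) :=
  continuousOn_univ.1 (h.comp (f := fun l : ℝ => (l, s)) (by fun_prop)
    fun _ _ => ⟨mem_univ _, hs⟩)

lemma even_ext {g w : ℝ → ℝ} (hg : Continuous g) (hw : Continuous w) (he : ∀ x, |g (-x)| = |g x|)
    (hwe : ∀ x, w (-x) = w x) (h : ∀ x, 0 < x → |g x| ≤ w x) (x : ℝ) : |g x| ≤ w x := by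
  rcases lt_trichotomy x 0 with hx | rfl | hx
  · rw [← he, ← hwe]; exact h (-x) (by linarith)
  · have h1 : Tendsto (fun x => |g x|) (𝓝[>] 0) (𝓝 |g 0|) := hg.abs.continuousAt.continuousWithinAt
    have h2 : Tendsto w (𝓝[>] 0) (𝓝 (w 0)) := hw.continuousAt.continuousWithinAt
    refine le_of_tendsto_of_tendsto h1 h2 ?_
    filter_upwards [self_mem_nhdsWithin] with y hy using h y hy
  · exact h x hx

lemma UD.ml_even (U : UD u n m ml ms) {l s : ℝ} (hs : 0 ≤ s) : ml (-l) s = ml l s := by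
  have o : ∀ l, m (-l) s = -m l s := fun l => by
    rw [U.mn _ _ hs, U.mn _ _ hs, U.even _ _ hs]; ring
  have := deriv_odd (f := fun l => m l s) o l
  rwa [(U.dml _ s hs).deriv, (U.dml _ s hs).deriv] at this

lemma UD.ms_odd (U : UD u n m ml ms) {l s : ℝ} (hs : 0 ≤ s) : ms (-l) s = -ms l s := by
  have o : ∀ s, 0 ≤ s → m (-l) s = -m l s := fun s hs => by
    rw [U.mn _ _ hs, U.mn _ _ hs, U.even _ _ hs]; ring
  refine (uniqueDiffOn_Ici (0:ℝ) s hs).eq_deriv _ (U.dms (-l) s hs) ?_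
  exact (U.dms l s hs).neg.congr (fun x hx => o x hx) (o s hs)

lemma UD.ub (U : UD u n m ml ms) {ν B : ℝ}
    (h : ∀ r t, 0 < r → 0 ≤ t → (1 + r) * |m r t / r| ≤ B * om ν (r - t) ∧
        r * |ml r t / r - m r t / r ^ 2| ≤ B * om ν (r - t) ∧
        r * |ms r t / r| ≤ B * om ν (r - t)) : UB ν B n ml ms := by
  have hw : ∀ s, Continuous (fun l => B * om ν (|l| - s)) := fun s =>
    continuous_const.mul ((om_cont ν).comp (by fun_prop))
  have hwe : ∀ s l, B * om ν (|(-l)| - s) = B * om ν (|l| - s) := fun s l => by rw [abs_neg]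
  constructor
  · intro l s hs
    have := even_ext (g := fun l => (1 + |l|) * n l s)
      (Continuous.mul (by fun_prop) (slice_cont' U.nc hs)) (hw s)
      (fun x => by simp only [abs_neg, U.even x s hs]) (hwe s) (fun r hr => by
        have := (h r s hr hs).1
        rw [U.mn _ _ hs, mul_div_cancel_left₀ _ hr.ne'] at this
        rw [abs_mul, abs_of_pos hr, abs_of_pos (by linarith)]
        exact this) l
    rwa [abs_mul, abs_of_pos (show 0 < 1 + |l| by positivity)] at this
  · intro l s hs
    refine even_ext (g := fun l => ml l s - n l s)
      ((slice_cont' U.mlc hs).sub (slice_cont' U.nc hs)) (hw s)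
      (fun x => by simp only [U.ml_even hs, U.even x s hs]) (hwe s) (fun r hr => ?_) l
    have := (h r s hr hs).2.1
    rw [U.mn _ _ hs] at this
    have e : r * |ml r s / r - r * n r s / r ^ 2| = |ml r s - n r s| := by
      nth_rewrite 1 [← abs_of_pos hr]
      rw [← abs_mul]; congr 1; field_simp
    rw [e] at this
    rwa [abs_of_pos hr]
  · intro l s hs
    refine even_ext (g := fun l => ms l s) (slice_cont' U.msc hs) (hw s)
      (fun x => by simp only [U.ms_odd hs, abs_neg]) (hwe s) (fun r hr => ?_) l
    have := (h r s hr hs).2.2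
    rw [abs_div, abs_of_pos hr, mul_div_cancel₀ _ hr.ne'] at this
    rwa [abs_of_pos hr]

lemma maj_parts {r v a b ar br bt M : ℝ} (hr : 0 < r) (h : maj r v a b ar br bt ≤ M) :
    (1 + r) * |b| ≤ M ∧ r * |br| ≤ M ∧ r * |bt| ≤ M := by
  unfold maj at h
  have h1 := abs_nonneg v
  have h2 : 0 ≤ (1 + r) * |a| := by positivity
  have h3 : 0 ≤ (1 + r) * |b| := by positivity
  have h4 : 0 ≤ r * |ar| := by positivity
  have h5 : 0 ≤ r * |br| := by positivity
  have h6 : 0 ≤ r * |bt| := by positivity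
  refine ⟨by linarith, by linarith, by linarith⟩

lemma UD.ub_of_Z (U : UD u n m ml ms) {ν : ℝ} (hν : 1 ≤ ν) (h : BddAbove (ZSet 2 ν u)) :
    UB ν (Znorm 2 ν u) n ml ms := by
  obtain ⟨a, ar, R⟩ := U.reg
  refine U.ub fun r t hr ht => ?_
  have h1 := (R.maj_le h le_rfl hr ht).trans
    (mul_le_mul_of_nonneg_left (wB_le_om hν hr.le ht) (Znorm_nonneg ν u))
  exact maj_parts hr h1

lemma maj_sub_le {r v a b ar br bt v' a' b' ar' br' bt' : ℝ} (hr : 0 < r) :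
    maj r (v - v') (a - a') (b - b') (ar - ar') (br - br') (bt - bt') ≤
      maj r v a b ar br bt + maj r v' a' b' ar' br' bt' := by
  unfold maj
  have h1 := abs_sub v v'
  have h2 := mul_le_mul_of_nonneg_left (abs_sub a a') (show 0 ≤ 1 + r by linarith)
  have h3 := mul_le_mul_of_nonneg_left (abs_sub b b') (show 0 ≤ 1 + r by linarith)
  have h4 := mul_le_mul_of_nonneg_left (abs_sub ar ar') hr.le
  have h5 := mul_le_mul_of_nonneg_left (abs_sub br br') hr.le
  have h6 := mul_le_mul_of_nonneg_left (abs_sub bt bt') hr.le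
  linarith

lemma UD.ub_of_K (U : UD u n m ml ms) {ν ε : ℝ} (hν : 1 ≤ ν) (hε : 0 ≤ ε)
    {fg : (ℝ → ℝ) × (ℝ → ℝ)} (hY : memY ν ε fg) (h : BddAbove (ZSet 2 ν (u - Kop fg)))
    (hz : Znorm 2 ν (u - Kop fg) ≤ ε) : UB ν ((CK ν + 1) * ε) n ml ms := by
  obtain ⟨a, ar, R⟩ := U.reg
  obtain ⟨mK, mlK, msK, aK, arK, RK, hK⟩ := K_data (by linarith) hε hY
  have RR := R.sub RK
  refine U.ub fun r t hr ht => ?_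
  have h1 := (RR.maj_le h hz hr ht).trans
    (mul_le_mul_of_nonneg_left (wB_le_om hν hr.le ht) hε)
  obtain ⟨p1, p2, p3⟩ := maj_parts hr h1
  obtain ⟨k1, k2, k3⟩ := hK r t hr ht
  have tri : ∀ (c x y P Q : ℝ), 0 ≤ c → c * |x - y| ≤ P → c * |y| ≤ Q → c * |x| ≤ P + Q :=
    fun c x y P Q hc h1 h2 => by
      have : |x| ≤ |x - y| + |y| := by simpa using abs_add_le (x - y) y
      nlinarith
  have e : (CK ν + 1) * ε * om ν (r - t) = ε * om ν (r - t) + CK ν * ε * om ν (r - t) := by ring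
  rw [e]
  exact ⟨tri _ _ _ _ _ (by linarith) p1 k1, tri _ _ _ _ _ hr.le p2 k2, tri _ _ _ _ _ hr.le p3 k3⟩

lemma bdd_diff (U : UD u n m ml ms) (U' : UD u' n' m' ml' ms') {ν ε : ℝ} (hν : 1 ≤ ν)
    (hε : 0 ≤ ε) {fg : (ℝ → ℝ) × (ℝ → ℝ)} (hY : memY ν ε fg)
    (h : BddAbove (ZSet 2 ν (u - Kop fg))) (h' : BddAbove (ZSet 2 ν (u' - Kop fg))) :
    BddAbove (ZSet 2 ν (u - u')) := by
  obtain ⟨a, ar, R⟩ := U.reg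
  obtain ⟨a', ar', R'⟩ := U'.reg
  obtain ⟨mK, mlK, msK, aK, arK, RK, -⟩ := K_data (by linarith) hε hY
  have R1 := R.sub RK
  have R2 := R'.sub RK
  have R3 : Reg (u - u') _ _ _ _ _ := (R1.sub R2).congr (fun r t _ _ => by simp)
  refine (ZSet_of_bound (M := Znorm 2 ν (u - Kop fg) + Znorm 2 ν (u' - Kop fg))
    fun r t hr ht => (R3.bracket_le hr ht).trans ?_).1
  have h1 := R1.maj_le h le_rfl hr ht
  have h2 := R2.maj_le h' le_rfl hr ht
  have e : (u - u') r t = (u - Kop fg) r t - (u' - Kop fg) r t := by simp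
  rw [add_mul]
  refine le_trans ?_ (add_le_add h1 h2)
  unfold majF
  rw [e]
  exact maj_sub_le hr

end

end

section

open Real MeasureTheory Filter Set Topology

noncomputable section

/-- Derivative of `|x|^p`. -/
def ph1 (p x : ℝ) : ℝ := p * |x| ^ (p - 2) * x

lemma ph1_cont {p : ℝ} (hp : 2 < p) : Continuous (ph1 p) := by
  unfold ph1
  refine (continuous_const.mul ?_).mul continuous_id
  exact Continuous.rpow_const continuous_abs fun x => Or.inr (by linarith)

lemma ph_deriv {p : ℝ} (hp : 2 < p) (x : ℝ) : HasDerivAt (fun x : ℝ => |x| ^ p) (ph1 p x) x :=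
  hasDerivAt_abs_rpow x (by linarith)

lemma ph1_bd {p x M : ℝ} (hp : 2 < p) (h : |x| ≤ M) : |ph1 p x| ≤ p * M ^ (p - 1) := by
  unfold ph1
  have e : |p * |x| ^ (p - 2) * x| = p * |x| ^ (p - 1) := by
    rw [abs_mul, abs_mul, abs_of_pos (by linarith : 0 < p),
      abs_of_nonneg (show 0 ≤ |x| ^ (p - 2) by positivity), mul_assoc]
    congr 1
    rcases (abs_nonneg x).eq_or_lt with h0 | h0
    · rw [← h0, mul_zero, Real.zero_rpow (by linarith)]
    · rw [← Real.rpow_add_one h0.ne']; congr 1; ring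
  rw [e]
  have : 0 ≤ p := by linarith
  gcongr
  linarith

lemma ph_lip {p x y M : ℝ} (hp : 2 < p) (hx : |x| ≤ M) (hy : |y| ≤ M) :
    |(|x| ^ p - |y| ^ p)| ≤ p * M ^ (p - 1) * |x - y| := by
  have := (convex_Icc (-M) M).norm_image_sub_le_of_norm_hasDerivWithin_le
    (f := fun x : ℝ => |x| ^ p) (f' := ph1 p) (C := p * M ^ (p - 1))
    (fun x _ => (ph_deriv hp x).hasDerivWithinAt)
    (fun x hx => ph1_bd hp (abs_le.2 hx)) (abs_le.1 hy) (abs_le.1 hx)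
  exact this

lemma ph1_deriv {p : ℝ} (hp : 2 < p) (x : ℝ) :
    HasDerivAt (ph1 p) (p * (p - 1) * |x| ^ (p - 2)) x := by
  have pos : ∀ x, 0 < x → HasDerivAt (ph1 p) (p * (p - 1) * |x| ^ (p - 2)) x := by
    intro x hx
    have h1 := (Real.hasDerivAt_rpow_const (p := p - 1) (Or.inl hx.ne')).const_mul p
    have e : (fun x : ℝ => p * x ^ (p - 1)) =ᶠ[𝓝 x] ph1 p := by
      filter_upwards [Ioi_mem_nhds hx] with y hy
      have hy : 0 < y := hy
      rw [ph1, abs_of_pos hy, mul_assoc, ← Real.rpow_add_one hy.ne']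
      congr 2; ring
    refine (h1.congr_of_eventuallyEq e.symm).congr_deriv ?_
    rw [abs_of_pos hx, show p - 1 - 1 = p - 2 by ring]; ring
  rcases lt_trichotomy x 0 with hx | rfl | hx
  · have h1 := ((pos (-x) (by linarith)).comp x (hasDerivAt_neg x)).neg
    have e : -(ph1 p ∘ Neg.neg) = ph1 p := by
      funext y; simp [ph1]
    rw [e] at h1
    refine h1.congr_deriv ?_
    rw [abs_neg]; ring
  · rw [abs_zero, Real.zero_rpow (by linarith), mul_zero, hasDerivAt_iff_tendsto_slope]
    have h1 : Tendsto (fun x : ℝ => p * |x| ^ (p - 2)) (𝓝[≠] 0) (𝓝 0) := by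
      have : Continuous (fun x : ℝ => p * |x| ^ (p - 2)) :=
        continuous_const.mul (Continuous.rpow_const continuous_abs fun x => Or.inr (by linarith))
      have h2 := this.tendsto 0
      rw [abs_zero, Real.zero_rpow (by linarith), mul_zero] at h2
      exact h2.mono_left nhdsWithin_le_nhds
    refine h1.congr' ?_
    filter_upwards [self_mem_nhdsWithin] with y hy
    have hy : y ≠ 0 := hy
    rw [slope_def_field]
    simp only [ph1, mul_zero, sub_zero]
    field_simp
  · exact pos x hx

lemma ph1_lip {p x y M : ℝ} (hp : 2 < p) (hx : |x| ≤ M) (hy : |y| ≤ M) :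
    |ph1 p x - ph1 p y| ≤ p * (p - 1) * M ^ (p - 2) * |x - y| := by
  have hpp : 0 ≤ p * (p - 1) := mul_nonneg (by linarith) (by linarith)
  have := (convex_Icc (-M) M).norm_image_sub_le_of_norm_hasDerivWithin_le
    (f := ph1 p) (f' := fun x => p * (p - 1) * |x| ^ (p - 2)) (C := p * (p - 1) * M ^ (p - 2))
    (fun x _ => (ph1_deriv hp x).hasDerivWithinAt)
    (fun x hx => by
      rw [Real.norm_eq_abs, abs_of_nonneg (by positivity)]
      have : |x| ≤ M := abs_le.2 hx
      gcongr) (abs_le.1 hy) (abs_le.1 hx)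
  exact this

/-- Pointwise algebraic bounds for the source. -/
lemma src_alg {p l x y X Y S T B N ω : ℝ} (hp : 2 < p) (hB : 0 ≤ B) (hω : 0 < ω)
    (x1 : (1 + |l|) * |x| ≤ B * ω) (y1 : (1 + |l|) * |y| ≤ B * ω)
    (y2 : |Y| ≤ B * ω) (y3 : |T| ≤ B * ω)
    (d1 : (1 + |l|) * |x - y| ≤ N * ω) (d2 : |X - Y| ≤ N * ω) (d3 : |S - T| ≤ N * ω) :
    |l * |x| ^ p - l * |y| ^ p| ≤
      (p + p ^ 2) * B ^ (p - 1) * N * ((1 + |l|) ^ (-(p - 1)) * ω ^ p) ∧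
    |(|x| ^ p + ph1 p x * X) - (|y| ^ p + ph1 p y * Y)| ≤
      (p + p ^ 2) * B ^ (p - 1) * N * ((1 + |l|) ^ (-(p - 1)) * ω ^ p) ∧
    |ph1 p x * S - ph1 p y * T| ≤
      (p + p ^ 2) * B ^ (p - 1) * N * ((1 + |l|) ^ (-(p - 1)) * ω ^ p) := by
  set L := 1 + |l| with hL
  have hL1 : 1 ≤ L := one_le_w l
  have hL0 : 0 < L := by linarith
  have hlL : |l| ≤ L := by linarith
  have hp0 : 0 < p := by linarith
  have hN : 0 ≤ N := by
    have : 0 ≤ N * ω := (abs_nonneg _).trans d2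
    exact nonneg_of_mul_nonneg_left this hω
  set M := B * ω / L with hM
  have hM0 : 0 ≤ M := by positivity
  have hx : |x| ≤ M := by rw [hM, le_div_iff₀ hL0]; linarith
  have hy : |y| ≤ M := by rw [hM, le_div_iff₀ hL0]; linarith
  have hd : |x - y| ≤ N * ω / L := by rw [le_div_iff₀ hL0]; linarith
  have eQ : M ^ (p - 1) * (N * ω) = B ^ (p - 1) * N * (L ^ (-(p - 1)) * ω ^ p) := by
    rw [hM, Real.div_rpow (by positivity) hL0.le, Real.mul_rpow hB hω.le, Real.rpow_neg hL0.le]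
    have : ω ^ p = ω ^ (p - 1) * ω := by
      rw [← Real.rpow_add_one hω.ne']; congr 1; ring
    rw [this]; ring
  set Q := M ^ (p - 1) * (N * ω) with hQ
  have hQ0 : 0 ≤ Q := by positivity
  have tgt : (p + p ^ 2) * B ^ (p - 1) * N * (L ^ (-(p - 1)) * ω ^ p) = (p + p ^ 2) * Q := by
    rw [eQ]; ring
  rw [tgt]
  have g1 : |(|x| ^ p - |y| ^ p)| * L ≤ p * Q := by
    have h1 := ph_lip hp hx hy
    have h2 : p * M ^ (p - 1) * |x - y| ≤ p * M ^ (p - 1) * (N * ω / L) := by gcongr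
    have h3 : p * M ^ (p - 1) * (N * ω / L) * L = p * Q := by rw [hQ]; field_simp
    nlinarith
  have g2 : ∀ Z W : ℝ, |W| ≤ B * ω → |Z - W| ≤ N * ω → |ph1 p x * Z - ph1 p y * W| ≤ p ^ 2 * Q := by
    intro Z W hW hZ
    have e : ph1 p x * Z - ph1 p y * W = ph1 p x * (Z - W) + (ph1 p x - ph1 p y) * W := by ring
    rw [e]
    refine (abs_add_le _ _).trans ?_
    rw [abs_mul, abs_mul]
    have h1 : |ph1 p x| * |Z - W| ≤ p * M ^ (p - 1) * (N * ω) :=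
      mul_le_mul (ph1_bd hp hx) hZ (abs_nonneg _) (by positivity)
    have hpp : 0 ≤ p * (p - 1) := mul_nonneg (by linarith) (by linarith)
    have h2 : |ph1 p x - ph1 p y| * |W| ≤
        p * (p - 1) * M ^ (p - 2) * (N * ω / L) * (B * ω) := by
      refine mul_le_mul ((ph1_lip hp hx hy).trans ?_) hW (abs_nonneg _) (by positivity)
      gcongr
    have h3 : M ^ (p - 2) * (N * ω / L) * (B * ω) = Q := by
      have : M ^ (p - 1) = M ^ (p - 2) * M := by
        rcases hM0.eq_or_lt with h0 | h0
        · rw [← h0, mul_zero, Real.zero_rpow (by linarith)]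
        · rw [← Real.rpow_add_one h0.ne']; congr 1; ring
      rw [hQ, this]
      nth_rewrite 3 [hM]
      ring
    have h4 : p * (p - 1) * M ^ (p - 2) * (N * ω / L) * (B * ω) = p * (p - 1) * Q := by
      rw [← h3]; ring
    have h5 : p * M ^ (p - 1) * (N * ω) = p * Q := by rw [hQ]; ring
    nlinarith
  have hp2 : 0 ≤ p ^ 2 * Q := by positivity
  refine ⟨?_, ?_, ?_⟩
  · rw [← mul_sub, abs_mul]
    have := mul_le_mul_of_nonneg_right hlL (abs_nonneg (|x| ^ p - |y| ^ p))
    nlinarith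
  · have e : (|x| ^ p + ph1 p x * X) - (|y| ^ p + ph1 p y * Y) =
        (|x| ^ p - |y| ^ p) + (ph1 p x * X - ph1 p y * Y) := by ring
    rw [e]
    refine (abs_add_le _ _).trans ?_
    have h1 := g2 X Y y2 d2
    have h2 : |(|x| ^ p - |y| ^ p)| ≤ |(|x| ^ p - |y| ^ p)| * L :=
      le_mul_of_one_le_right (abs_nonneg _) hL1
    linarith
  · have := g2 S T y3 d3
    have : 0 ≤ p * Q := by positivity
    linarith

end

end

section

open Real MeasureTheory Filter Set Topology

noncomputable section

variable {u n m ml ms u' n' m' ml' ms' : ℝ → ℝ → ℝ}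

lemma deriv_id_mul {g : ℝ → ℝ} (hg : ContinuousAt g 0) :
    HasDerivAt (fun x => x * g x) (g 0) 0 := by
  rw [hasDerivAt_iff_tendsto_slope]
  refine (hg.tendsto.mono_left nhdsWithin_le_nhds).congr' ?_
  filter_upwards [self_mem_nhdsWithin] with x hx
  have : x ≠ 0 := hx
  simp [slope_def_field]
  field_simp

lemma UD.n_cont (U : UD u n m ml ms) {s : ℝ} (hs : 0 ≤ s) : Continuous (fun l => n l s) :=
  slice_cont' U.nc hs

lemma UD.ml_zero (U : UD u n m ml ms) {s : ℝ} (hs : 0 ≤ s) : ml 0 s = n 0 s := by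
  refine (U.dml 0 s hs).unique ?_
  have := deriv_id_mul (U.n_cont hs).continuousAt
  exact this.congr_of_eventuallyEq (Eventually.of_forall fun l => U.mn l s hs)

lemma UD.dl (U : UD u n m ml ms) {p : ℝ} (hp : 2 < p) (l : ℝ) {s : ℝ} (hs : 0 ≤ s) :
    HasDerivAt (fun l => l * |n l s| ^ p)
      (|n l s| ^ p + ph1 p (n l s) * (ml l s - n l s)) l := by
  rcases eq_or_ne l 0 with rfl | hl
  · rw [U.ml_zero hs, sub_self, mul_zero, add_zero]
    refine deriv_id_mul (g := fun l => |n l s| ^ p) ?_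
    exact ((U.n_cont hs).abs.rpow_const fun x => Or.inr (by linarith)).continuousAt
  · have h1 : HasDerivAt (fun l => n l s) ((ml l s - n l s) / l) l := by
      have h2 := (U.dml l s hs).div (hasDerivAt_id l) hl
      have h3 : HasDerivAt (fun l => n l s) ((ml l s * id l - m l s * 1) / (id l) ^ 2) l := by
        refine h2.congr_of_eventuallyEq ?_
        filter_upwards [isOpen_ne.mem_nhds hl] with x hx
        have : x ≠ 0 := hx
        simp only [Pi.div_apply, U.mn x s hs, id]
        field_simp
      convert h3 using 1
      rw [U.mn l s hs]
      simp only [id]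
      field_simp
    have h5 : HasDerivAt (fun l => |n l s| ^ p) (ph1 p (n l s) * ((ml l s - n l s) / l)) l :=
      HasDerivAt.comp (h₂ := fun x : ℝ => |x| ^ p) l (ph_deriv hp (n l s)) h1
    have h4 : HasDerivAt (fun l => l * |n l s| ^ p)
        (1 * |n l s| ^ p + l * (ph1 p (n l s) * ((ml l s - n l s) / l))) l :=
      (hasDerivAt_id l).mul h5
    have e : |n l s| ^ p + ph1 p (n l s) * (ml l s - n l s) =
        1 * |n l s| ^ p + l * (ph1 p (n l s) * ((ml l s - n l s) / l)) := by
      field_simp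
    rw [e]
    exact h4

lemma UD.ds (U : UD u n m ml ms) {p : ℝ} (hp : 2 < p) (l : ℝ) {s : ℝ} (hs : 0 < s) :
    HasDerivAt (fun s => l * |n l s| ^ p) (ph1 p (n l s) * ms l s) s := by
  have hN : Ici (0:ℝ) ∈ 𝓝 s := Ici_mem_nhds hs
  have hm : HasDerivAt (fun s => m l s) (ms l s) s := (U.dms l s hs.le).hasDerivAt hN
  rcases eq_or_ne l 0 with rfl | hl
  · have : ms 0 s = 0 := by
      have := U.ms_odd (l := 0) hs.le
      rw [neg_zero] at this
      linarith
    rw [this, mul_zero]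
    simpa using hasDerivAt_const s (0:ℝ)
  · have h1 : HasDerivAt (fun s => n l s) (ms l s / l) s := by
      refine (hm.div_const l).congr_of_eventuallyEq ?_
      filter_upwards [hN] with x hx
      rw [U.mn l x hx]
      field_simp
    have h4 : HasDerivAt (fun s => l * |n l s| ^ p) (l * (ph1 p (n l s) * (ms l s / l))) s :=
      ((ph_deriv hp (n l s)).comp s h1).const_mul l
    have e : ph1 p (n l s) * ms l s = l * (ph1 p (n l s) * (ms l s / l)) := by
      field_simp
    rw [e]
    exact h4

lemma clamp_cont {F : ℝ → ℝ → ℝ} (h : ContinuousOn (Function.uncurry F) (univ ×ˢ Ici (0:ℝ))) :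
    Continuous (fun z : ℝ × ℝ => F z.1 (max z.2 0)) :=
  h.comp_continuous (f := fun z : ℝ × ℝ => (z.1, max z.2 0)) (by fun_prop)
    fun z => ⟨mem_univ _, le_max_right z.2 (0:ℝ)⟩

lemma om_rpow (ν p x : ℝ) : om ν x ^ p = (1 + |x|) ^ (-(ν * p)) := by
  unfold om
  rw [← Real.rpow_mul (by positivity)]
  ring_nf

/-- Build a `Src` from a bound at nonnegative times for the clamped function. -/
lemma src_clamp {F : ℝ → ℝ → ℝ} {k d A : ℝ} (hd : 0 ≤ d) (hA : 0 ≤ A)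
    (hc : Continuous (fun z : ℝ × ℝ => F z.1 (max z.2 0)))
    (hb : ∀ l s, 0 ≤ s → |F l s| ≤ A * wt k d l s) :
    Src k d A (fun l s => F l (max s 0)) where
  cont := hc
  bd0 l s := (hb l _ (le_max_right _ _)).trans
    (mul_le_mul_of_nonneg_left (wt_le hd l _) hA)
  bd l s hs := by
    simp only [max_eq_left hs]
    exact hb l s hs

lemma core_src (U : UD u n m ml ms) (U' : UD u' n' m' ml' ms') {p ν B N : ℝ} (hp : 2 < p)
    (hν : 0 ≤ ν) (hB : 0 ≤ B) (hN : 0 ≤ N) (b : UB ν B n ml ms) (b' : UB ν B n' ml' ms')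
    (c : UB ν N (n - n') (ml - ml') (ms - ms')) :
    SrcC1 (p - 1) (ν * p) ((p + p ^ 2) * B ^ (p - 1) * N)
      (fun l s => l * |n l (max s 0)| ^ p - l * |n' l (max s 0)| ^ p)
      (fun l s => (|n l (max s 0)| ^ p + ph1 p (n l (max s 0)) * (ml l (max s 0) - n l (max s 0)))
        - (|n' l (max s 0)| ^ p +
          ph1 p (n' l (max s 0)) * (ml' l (max s 0) - n' l (max s 0))))
      (fun l s => ph1 p (n l (max s 0)) * ms l (max s 0)
        - ph1 p (n' l (max s 0)) * ms' l (max s 0)) := by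
  have hA : 0 ≤ (p + p ^ 2) * B ^ (p - 1) * N := by positivity
  have hd : 0 ≤ ν * p := by positivity
  have key := fun l s (hs : 0 ≤ s) => src_alg (l := l) hp hB (om_pos ν (|l| - s))
    (b.b1 l s hs) (b'.b1 l s hs) (b'.b2 l s hs) (b'.b3 l s hs) (c.b1 l s hs)
    (X := ml l s - n l s) (S := ms l s) (N := N)
    (by
      have := c.b2 l s hs
      simp only [Pi.sub_apply] at this
      convert this using 2; ring) (c.b3 l s hs)
  simp only [om_rpow] at key
  have cn := clamp_cont U.nc
  have cn' := clamp_cont U'.nc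
  have cl := clamp_cont U.mlc
  have cl' := clamp_cont U'.mlc
  have cs := clamp_cont U.msc
  have cs' := clamp_cont U'.msc
  have r1 := cn.abs.rpow_const (p := p) fun x => Or.inr (by linarith)
  have r1' := cn'.abs.rpow_const (p := p) fun x => Or.inr (by linarith)
  have r2 := (ph1_cont hp).comp cn
  have r2' := (ph1_cont hp).comp cn'
  refine ⟨?_, ?_, ?_, ?_, ?_, ?_⟩
  · exact src_clamp (F := fun l s => l * |n l s| ^ p - l * |n' l s| ^ p) hd hA
      ((continuous_fst.mul r1).sub (continuous_fst.mul r1')) fun l s hs => (key l s hs).1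
  · exact src_clamp (F := fun l s => (|n l s| ^ p + ph1 p (n l s) * (ml l s - n l s)) -
        (|n' l s| ^ p + ph1 p (n' l s) * (ml' l s - n' l s))) hd hA
      ((r1.add (r2.mul (cl.sub cn))).sub (r1'.add (r2'.mul (cl'.sub cn'))))
      fun l s hs => (key l s hs).2.1
  · exact src_clamp (F := fun l s => ph1 p (n l s) * ms l s - ph1 p (n' l s) * ms' l s) hd hA
      ((r2.mul cs).sub (r2'.mul cs')) fun l s hs => (key l s hs).2.2
  · intro l s
    exact (U.dl hp l (le_max_right s 0)).sub (U'.dl hp l (le_max_right s 0))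
  · intro l s hs
    have := (U.ds hp l hs).sub (U'.ds hp l hs)
    simp only [max_eq_left hs.le]
    refine this.congr_of_eventuallyEq ?_
    filter_upwards [Ioi_mem_nhds hs] with x hx
    simp only [max_eq_left (le_of_lt (show (0:ℝ) < x from hx)), Pi.sub_apply]
  · intro l s
    simp only [U.even l _ (le_max_right s 0), U'.even l _ (le_max_right s 0)]
    ring

lemma UD.pdt_eq (U : UD u n m ml ms) {l s : ℝ} (hs : 0 < s) : pdt u l s = n l s :=
  ((U.dt l s hs.le).hasDerivAt (Ici_mem_nhds hs)).deriv

lemma core (p q : ℝ) (hp : 2 < p) (hq : 2 < q) :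
    ∃ C > 0, ∀ ε : ℝ, 0 < ε → ε ≤ 1 → ∀ fg : (ℝ → ℝ) × (ℝ → ℝ), memY (q - 1) ε fg →
      ∀ u u' : ℝ → ℝ → ℝ, memX 2 u → memX 2 u' →
        BddAbove (ZSet 2 (q - 1) (u - Kop fg)) → Znorm 2 (q - 1) (u - Kop fg) ≤ ε →
        BddAbove (ZSet 2 (q - 1) (u' - Kop fg)) → Znorm 2 (q - 1) (u' - Kop fg) ≤ ε →
        BddAbove (ZSet 2 (p - 1) (Rop (NLt p u - NLt p u'))) ∧
          Znorm 2 (p - 1) (Rop (NLt p u - NLt p u')) ≤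
            C * ε ^ (p - 1) * Znorm 2 (q - 1) (u - u') := by
  have hK : 0 ≤ CK (q - 1) + 1 := by unfold CK; positivity
  have hC2 := C2_nonneg (k := p - 1) (d := (q - 1) * p) (by linarith)
  have hp0 : 0 < p := by linarith
  refine ⟨C2 (p - 1) ((q - 1) * p) * ((p + p ^ 2) * (CK (q - 1) + 1) ^ (p - 1)) + 1,
    by positivity, ?_⟩
  intro ε hε _ fg hY u u' hu hu' hb hz hb' hz'
  obtain ⟨n, m, ml, ms, U⟩ := exists_UD hu
  obtain ⟨n', m', ml', ms', U'⟩ := exists_UD hu'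
  have hν : 1 ≤ q - 1 := by linarith
  have hN := Znorm_nonneg (q - 1) (u - u')
  have S := core_src U U' hp (by linarith) (mul_nonneg hK hε.le) hN
    (U.ub_of_K hν hε.le hY hb hz) (U'.ub_of_K hν hε.le hY hb' hz')
    ((U.sub U').ub_of_Z hν (bdd_diff U U' hν hε.le hY hb hb'))
  have hk : 1 < p - 1 := by linarith
  obtain ⟨f1, f2⟩ := S.final hk (by nlinarith) (w := Rop (NLt p u - NLt p u')) (by
    intro r t hr ht
    rw [Phi_eq S.h hk t hr.le, Rop]
    have : ∀ s ∈ Ioi t, (∫ l in ((s - t) - r)..((s - t) + r), l * (NLt p u - NLt p u') l s) =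
        ∫ l in ((s - t) - r)..((s - t) + r),
          (l * |n l (max s 0)| ^ p - l * |n' l (max s 0)| ^ p) := by
      intro s hs
      have hs0 : 0 < s := lt_of_le_of_lt ht hs
      congr 1
      funext l
      simp only [Pi.sub_apply, NLt, U.pdt_eq hs0, U'.pdt_eq hs0, max_eq_left hs0.le]
      ring
    rw [setIntegral_congr_fun measurableSet_Ioi this]
    field_simp)
  refine ⟨f1, f2.trans ?_⟩
  rw [Real.mul_rpow hK hε.le]
  have : 0 ≤ ε ^ (p - 1) * Znorm 2 (q - 1) (u - u') := by positivity
  nlinarith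

end

end

/-- **Lemma 4.1, estimates (ko10)/(ko11).** For `p > 2`, `p ≤ q`, `0 < ε ≤ 1` and
`(u₁, u₂), (u₁^*, u₂^*) ∈ D_ε`:
`‖R(|∂_t u₂|^p - |∂_t u₂^*|^p)‖_{Z²(κ₁)} ≤ C ε^{p-1} ‖u₂ - u₂^*‖_{Z²(κ₂)}` and
`‖R(|∂_t u₁|^q - |∂_t u₁^*|^q)‖_{Z²(κ₂)} ≤ C ε^{q-1} ‖u₁ - u₁^*‖_{Z²(κ₁)}`. -/
theorem stmt10 (p q : ℝ) (hp : 2 < p) (hpq : p ≤ q) :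
    ∃ C > 0, ∀ ε : ℝ, 0 < ε → ε ≤ 1 →
      ∀ fg1 fg2 : (ℝ → ℝ) × (ℝ → ℝ), memY (p - 1) ε fg1 → memY (q - 1) ε fg2 →
      ∀ u₁ u₂ u₁' u₂' : ℝ → ℝ → ℝ,
        memX 2 u₁ → memX 2 u₂ → memX 2 u₁' → memX 2 u₂' →
        BddAbove (ZSet 2 (p - 1) (u₁ - Kop fg1)) →
        BddAbove (ZSet 2 (q - 1) (u₂ - Kop fg2)) →
        Znorm 2 (p - 1) (u₁ - Kop fg1) + Znorm 2 (q - 1) (u₂ - Kop fg2) ≤ ε →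
        BddAbove (ZSet 2 (p - 1) (u₁' - Kop fg1)) →
        BddAbove (ZSet 2 (q - 1) (u₂' - Kop fg2)) →
        Znorm 2 (p - 1) (u₁' - Kop fg1) + Znorm 2 (q - 1) (u₂' - Kop fg2) ≤ ε →
        (BddAbove (ZSet 2 (p - 1) (Rop (NLt p u₂ - NLt p u₂'))) ∧
          Znorm 2 (p - 1) (Rop (NLt p u₂ - NLt p u₂')) ≤
            C * ε ^ (p - 1) * Znorm 2 (q - 1) (u₂ - u₂')) ∧
        (BddAbove (ZSet 2 (q - 1) (Rop (NLt q u₁ - NLt q u₁'))) ∧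
          Znorm 2 (q - 1) (Rop (NLt q u₁ - NLt q u₁')) ≤
            C * ε ^ (q - 1) * Znorm 2 (p - 1) (u₁ - u₁')) := by
  obtain ⟨C₁, hC₁, h1⟩ := core p q hp (by linarith)
  obtain ⟨C₂, hC₂, h2⟩ := core q p (by linarith) hp
  refine ⟨C₁ + C₂, by linarith, ?_⟩
  intro ε hε hε1 fg1 fg2 hY1 hY2 u₁ u₂ u₁' u₂' m1 m2 m1' m2' b1 b2 hz b1' b2' hz'
  have z1 := Znorm_nonneg (p - 1) (u₁ - Kop fg1)
  have z2 := Znorm_nonneg (q - 1) (u₂ - Kop fg2)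
  have z1' := Znorm_nonneg (p - 1) (u₁' - Kop fg1)
  have z2' := Znorm_nonneg (q - 1) (u₂' - Kop fg2)
  obtain ⟨a1, a2⟩ := h1 ε hε hε1 fg2 hY2 u₂ u₂' m2 m2' b2 (by linarith) b2' (by linarith)
  obtain ⟨a3, a4⟩ := h2 ε hε hε1 fg1 hY1 u₁ u₁' m1 m1' b1 (by linarith) b1' (by linarith)
  have n1 := Znorm_nonneg (q - 1) (u₂ - u₂')
  have n2 := Znorm_nonneg (p - 1) (u₁ - u₁')
  refine ⟨⟨a1, a2.trans ?_⟩, ⟨a3, a4.trans ?_⟩⟩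
  · gcongr
    linarith
  · gcongr
    linarith
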